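/- arXiv:2411.03674 — 2 statements merged into one kernel-verified Lean document; each statement's English description precedes it below -/
import Mathlib

section
/- Let k ≥ 4, t ≥ 0 and n ≥ 2k+t be integers. Let ℱ ⊆ ([n] choose k+t) and 𝒢 ⊆ ([n] choose k) be cross-intersecting families. If ℱ is (t+1)-intersecting and |ℱ| ≥ 3, then |ℱ| + |𝒢| ≤ C(n,k) − C(n−k−t,k) − C(n−k−t−1,k−1) − C(n−k−t−2,k−2) + 3. Moreover, for n > 2k+t, equality holds if and only if, up to a permutation of [n], ℱ = {F₁, F₂, F₃} with Fᵢ = [k+t−1] ∪ {k+t−1+i} for each i ∈ {1,2,3} and 𝒢 = {G ∈ ([n] choose k) : G ∩ Fᵢ ≠ ∅ for i = 1,2,3}, or k = 4 and ℱ = {[t+3] ∪ {i} : i ∈ {t+4,…,n}} and 𝒢 = {G ∈ ([n] choose 4) : G ∩ [t+3] ≠ ∅}. -/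
open Finset

/-- The `k`-element subsets of members of `𝒜`. -/
def kShadow {α : Type*} [DecidableEq α] (k : ℕ) (𝒜 : Finset (Finset α)) : Finset (Finset α) :=
  𝒜.biUnion (powersetCard k)

section kShadow

variable {α : Type*} [DecidableEq α] {k s : ℕ} {𝒜 ℬ : Finset (Finset α)} {A B C K T : Finset α}

lemma mem_kShadow : K ∈ kShadow k 𝒜 ↔ ∃ A ∈ 𝒜, K ⊆ A ∧ #K = k := by
  simp [kShadow, mem_powersetCard]

lemma kShadow_mono (h : 𝒜 ⊆ ℬ) : kShadow k 𝒜 ⊆ kShadow k ℬ :=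
  biUnion_subset_biUnion_of_subset_left _ h

lemma kShadow_eq_shadow_iterate (h : ∀ A ∈ 𝒜, #A = k + s) :
    kShadow k 𝒜 = shadow^[s] 𝒜 := by
  ext K
  rw [mem_kShadow, mem_shadow_iterate_iff_exists_mem_card_add]
  refine exists_congr fun A => and_congr_right fun hA => and_congr_right fun _ => ?_
  rw [h A hA]
  omega

lemma card_filter_superset_powersetCard (hT : T ⊆ A) (hk : #T ≤ k) :
    #{K ∈ powersetCard k A | T ⊆ K} = (#A - #T).choose (k - #T) := by
  rw [← card_sdiff_of_subset hT, ← card_powersetCard]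
  refine card_bij' (fun K _ => K \ T) (fun L _ => L ∪ T) ?_ ?_ ?_ ?_
  · intro K hK
    simp only [mem_filter, mem_powersetCard] at hK ⊢
    exact ⟨sdiff_subset_sdiff hK.1.1 le_rfl, by rw [card_sdiff_of_subset hK.2, hK.1.2]⟩
  · intro L hL
    simp only [mem_filter, mem_powersetCard] at hL ⊢
    refine ⟨⟨union_subset (hL.1.trans sdiff_subset) hT, ?_⟩, subset_union_right⟩
    rw [card_union_of_disjoint (disjoint_sdiff_self_left.mono_left hL.1), hL.2]
    omega
  · intro K hK
    exact sdiff_union_of_subset (mem_filter.1 hK).2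
  · intro L hL
    have := (mem_powersetCard.1 hL).1
    exact union_sdiff_cancel_right (disjoint_sdiff_self_left.mono_left this)

lemma card_kShadow_add_le_card_kShadow_insert {j : ℕ} (hA : #A = k + s) (hTA : T ⊆ A)
    (hTj : #T ≤ j) (hj : j ≤ k) (hT : ∀ B ∈ 𝒜, ¬ T ⊆ B) :
    #(kShadow k 𝒜) + (k + s - j).choose s ≤ #(kShadow k (insert A 𝒜)) := by
  have hdisj : Disjoint (kShadow k 𝒜) {K ∈ powersetCard k A | T ⊆ K} := by
    rw [disjoint_left]
    intro K hK hK'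
    obtain ⟨B, hB, hKB, -⟩ := mem_kShadow.1 hK
    exact hT B hB ((mem_filter.1 hK').2.trans hKB)
  have hsub : kShadow k 𝒜 ∪ {K ∈ powersetCard k A | T ⊆ K} ⊆ kShadow k (insert A 𝒜) := by
    refine union_subset (kShadow_mono (subset_insert _ _)) fun K hK => ?_
    rw [mem_filter, mem_powersetCard] at hK
    exact mem_kShadow.2 ⟨A, mem_insert_self _ _, hK.1⟩
  have h := card_le_card hsub
  rw [card_union_of_disjoint hdisj, card_filter_superset_powersetCard hTA (hTj.trans hj), hA] at h
  have h2 : (k + s - #T).choose (k - #T) = (k + s - #T).choose s :=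
    Nat.choose_symm_of_eq_add (by omega)
  have h3 : (k + s - j).choose s ≤ (k + s - #T).choose s := Nat.choose_le_choose _ (by omega)
  omega

lemma exists_card_le_forall_not_subset (h : ∀ B ∈ 𝒜, ¬ A ⊆ B) :
    ∃ T ⊆ A, #T ≤ #𝒜 ∧ ∀ B ∈ 𝒜, ¬ T ⊆ B := by
  have h' : ∀ B : 𝒜, ∃ x ∈ A, x ∉ B.1 := fun B => not_subset.1 (h B.1 B.2)
  choose f hfA hfB using h'
  refine ⟨𝒜.attach.image f, ?_, ?_, ?_⟩
  · exact image_subset_iff.2 fun B _ => hfA B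
  · simpa using card_image_le (s := 𝒜.attach) (f := f)
  · exact fun B hB hT => hfB ⟨B, hB⟩ (hT (mem_image_of_mem f (mem_attach _ _)))

lemma card_kShadow_add_sum_le (h𝒜 : ∀ A ∈ 𝒜, #A = k + s) (hℬ : ℬ ⊆ 𝒜) (hk : #𝒜 ≤ k + 1) :
    #(kShadow k ℬ) + ∑ j ∈ Ico #ℬ #𝒜, (k + s - j).choose s ≤ #(kShadow k 𝒜) := by
  induction 𝒜 using Finset.strongInduction with
  | H 𝒜 ih =>
    obtain rfl | hssub := hℬ.eq_or_ssubset
    · simp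
    obtain ⟨A, hA, hAℬ⟩ := exists_of_ssubset hssub
    have hcard := card_erase_add_one hA
    have hℬ' : ℬ ⊆ 𝒜.erase A := subset_erase.2 ⟨hℬ, hAℬ⟩
    have ih := ih _ (erase_ssubset hA) (fun B hB => h𝒜 B (mem_of_mem_erase hB)) hℬ' (by omega)
    have hns : ∀ B ∈ 𝒜.erase A, ¬ A ⊆ B := fun B hB h => (mem_erase.1 hB).1
      (eq_of_subset_of_card_le h (by rw [h𝒜 A hA, h𝒜 B (mem_of_mem_erase hB)])).symm
    obtain ⟨T, hTA, hT, hTB⟩ := exists_card_le_forall_not_subset hns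
    have := card_kShadow_add_le_card_kShadow_insert (h𝒜 A hA) hTA hT (by omega) hTB
    rw [insert_erase hA] at this
    rw [← hcard, sum_Ico_succ_top (card_le_card hℬ')]
    omega

end kShadow

section SmallFamilies

lemma sum_range_choose_sub (k s : ℕ) :
    ∑ j ∈ range (k + 1), (k + s - j).choose s = (k + s + 1).choose (s + 1) := by
  induction k with
  | zero => simp
  | succ k ih =>
    have h := Nat.choose_succ_succ (k + s + 1) s
    simp only [Nat.succ_eq_add_one] at h
    rw [sum_range_succ', Nat.sub_zero, show k + 1 + s = k + s + 1 by omega, h, ← ih, add_comm]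
    congr 1
    exact sum_congr rfl fun j _ => by rw [Nat.add_sub_add_right]

lemma add_add_one_le_choose {a b : ℕ} (ha : 2 ≤ a) (hb : 2 ≤ b) :
    a + b + 1 ≤ (a + b).choose b := by
  induction a, ha using Nat.le_induction with
  | base =>
    rw [← Nat.choose_symm_add, Nat.choose_two_right, Nat.le_div_iff_mul_le (by omega)]
    have : 2 + b - 1 = b + 1 := by omega
    rw [this]
    nlinarith
  | succ a ha ih =>
    have : 0 < (a + b).choose (b - 1) := Nat.choose_pos (by omega)
    obtain ⟨b, rfl⟩ : ∃ c, b = c + 1 := ⟨b - 1, by omega⟩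
    have h := Nat.choose_succ_succ (a + (b + 1)) b
    rw [show a + 1 + (b + 1) = (a + (b + 1)).succ by omega, h]
    simp only [Nat.succ_eq_add_one, Nat.add_sub_cancel] at *
    omega

/-- The size of the `k`-shadow of three `(k + s)`-subsets of a `(k + s + 1)`-set. -/
def tripleShadow (k s : ℕ) : ℕ :=
  (k + s).choose s + (k + s - 1).choose s + (k + s - 2).choose s

lemma choose_eq_tripleShadow_add {k s : ℕ} (hk : 3 ≤ k) :
    (k + s + 1).choose (s + 1) = tripleShadow k s + (k + s - 2).choose (s + 1) := by
  obtain ⟨k, rfl⟩ : ∃ c, k = c + 3 := ⟨k - 3, by omega⟩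
  have h1 : (k + s + 4).choose (s + 1) = (k + s + 3).choose s + (k + s + 3).choose (s + 1) :=
    Nat.choose_succ_succ _ _
  have h2 : (k + s + 3).choose (s + 1) = (k + s + 2).choose s + (k + s + 2).choose (s + 1) :=
    Nat.choose_succ_succ _ _
  have h3 : (k + s + 2).choose (s + 1) = (k + s + 1).choose s + (k + s + 1).choose (s + 1) :=
    Nat.choose_succ_succ _ _
  rw [tripleShadow, show k + 3 + s = k + s + 3 by omega, show k + s + 3 + 1 = k + s + 4 by omega,
    show k + s + 3 - 1 = k + s + 2 by omega,
    show k + s + 3 - 2 = k + s + 1 by omega]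
  omega

lemma tripleShadow_add_le_choose {k s : ℕ} (hk : 4 ≤ k) (hs : 1 ≤ s) :
    tripleShadow k s + (k + s - 2) ≤ (k + s + 1).choose (s + 1) ∧
      (tripleShadow k s + (k + s - 2) = (k + s + 1).choose (s + 1) → k = 4) := by
  rw [choose_eq_tripleShadow_add (by omega)]
  obtain rfl | hk : k = 4 ∨ 5 ≤ k := by omega
  · rw [show 4 + s - 2 = s + 1 + 1 by omega, Nat.choose_succ_self_right]
    simp
  · have := add_add_one_le_choose (a := k - 3) (b := s + 1) (by omega) (by omega)
    rw [show k - 3 + (s + 1) = k + s - 2 by omega] at this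
    omega

variable {α : Type*} [DecidableEq α] {k s : ℕ} {𝒜 : Finset (Finset α)}

lemma choose_le_card_kShadow (h𝒜 : ∀ A ∈ 𝒜, #A = k + s) (hk : k + 1 ≤ #𝒜) :
    (k + s + 1).choose (s + 1) ≤ #(kShadow k 𝒜) := by
  obtain ⟨ℬ, hℬ, hcard⟩ := exists_subset_card_eq hk
  have h := card_kShadow_add_sum_le (k := k) (s := s) (fun A hA => h𝒜 A (hℬ hA))
    (empty_subset ℬ) hcard.le
  rw [card_empty, hcard, ← range_eq_Ico, sum_range_choose_sub] at h
  exact (le_add_self.trans h).trans (card_le_card (kShadow_mono hℬ))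

lemma tripleShadow_eq_sum (k s : ℕ) :
    ∑ j ∈ range 3, (k + s - j).choose s = tripleShadow k s := by
  simp [sum_range_succ, tripleShadow]

lemma tripleShadow_add_card_le_of_card_le (hk : 4 ≤ k) (hs : 1 ≤ s) (h𝒜 : ∀ A ∈ 𝒜, #A = k + s)
    (h3 : 3 ≤ #𝒜) (hle : #𝒜 ≤ k + s + 1) :
    tripleShadow k s + #𝒜 ≤ #(kShadow k 𝒜) + 3 ∧
      (tripleShadow k s + #𝒜 = #(kShadow k 𝒜) + 3 → #𝒜 = 3 ∨ k = 4 ∧ #𝒜 = k + s + 1) := by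
  obtain hk' | hk' := Nat.lt_or_ge k #𝒜
  · have h1 := choose_le_card_kShadow h𝒜 hk'
    have h2 := tripleShadow_add_le_choose hk hs
    omega
  · have h := card_kShadow_add_sum_le (k := k) (s := s) h𝒜 (empty_subset 𝒜) (by omega)
    rw [card_empty, ← sum_Ico_consecutive _ (Nat.zero_le 3) h3, ← range_eq_Ico,
      tripleShadow_eq_sum] at h
    have hpos : ∀ j ∈ Ico 3 #𝒜, 1 ≤ (k + s - j).choose s := fun j hj =>
      Nat.choose_pos (by have := mem_Ico.1 hj; omega)
    have hsum := sum_le_sum hpos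
    simp only [sum_const, Nat.card_Ico, smul_eq_mul, mul_one] at hsum
    obtain h4 | h4 : #𝒜 = 3 ∨ 4 ≤ #𝒜 := by omega
    · omega
    have hlt : ∑ j ∈ Ico 3 #𝒜, 1 < ∑ j ∈ Ico 3 #𝒜, (k + s - j).choose s := by
      refine sum_lt_sum hpos ⟨3, mem_Ico.2 ⟨le_rfl, h4⟩, ?_⟩
      have : (s + 1).choose s ≤ (k + s - 3).choose s := Nat.choose_le_choose _ (by omega)
      rw [Nat.choose_succ_self_right] at this
      omega
    simp only [sum_const, Nat.card_Ico, smul_eq_mul, mul_one] at hlt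
    omega

lemma card_kShadow_pair {A B : Finset α} (hA : #A = k + s) (hB : #B = k + s) :
    #(kShadow k {A, B}) + (#(A ∩ B)).choose k = 2 * (k + s).choose k := by
  have h := card_union_add_card_inter (powersetCard k A) (powersetCard k B)
  have h2 : powersetCard k A ∩ powersetCard k B = powersetCard k (A ∩ B) := by
    ext; simp [mem_powersetCard, subset_inter_iff]; tauto
  have h3 : kShadow k {A, B} = powersetCard k A ∪ powersetCard k B := by
    simp [kShadow]
  rw [h3]
  rw [h2] at h
  simp only [card_powersetCard, hA, hB] at h
  omega

lemma card_union_of_card_kShadow_pair_le (hk : 2 ≤ k) (hs : 1 ≤ s) {A B : Finset α} (hAB : A ≠ B)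
    (hA : #A = k + s) (hB : #B = k + s)
    (h : #(kShadow k {A, B}) ≤ (k + s).choose s + (k + s - 1).choose s) :
    #(A ∪ B) = k + s + 1 := by
  have h1 := card_kShadow_pair hA hB
  have h2 := card_union_add_card_inter A B
  have h3 : #(A ∩ B) < k + s := by
    by_contra! h3
    have hAi : A ∩ B = A := eq_of_subset_of_card_le inter_subset_left (by omega)
    have hBi : A ∩ B = B := eq_of_subset_of_card_le inter_subset_right (by omega)
    exact hAB (hAi.symm.trans hBi)
  obtain ⟨m, hm⟩ : ∃ m, k + s = m + 2 := ⟨k + s - 2, by omega⟩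
  suffices m + 1 ≤ #(A ∩ B) by omega
  by_contra! h4
  have h5 : (#(A ∩ B)).choose k ≤ m.choose k := Nat.choose_le_choose _ (by omega)
  have e1 : (k + s).choose s = (k + s).choose k := Nat.choose_symm_add.symm
  have e2 : (k + s - 1).choose s = (k + s - 1).choose (k - 1) :=
    Nat.choose_symm_of_eq_add (by omega)
  rw [e1, e2] at h
  obtain ⟨k, rfl⟩ : ∃ c, k = c + 1 := ⟨k - 1, by omega⟩
  rw [show k + 1 - 1 = k by omega, hm, show m + 2 - 1 = m + 1 by omega] at h
  rw [hm] at h1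
  have p1 := Nat.choose_succ_succ (m + 1) k
  have p2 := Nat.choose_succ_succ m k
  have p3 : 0 < m.choose k := Nat.choose_pos (by omega)
  simp only [Nat.succ_eq_add_one, show m + 1 + 1 = m + 2 by omega] at p1 p2
  omega

lemma subset_union_of_card_kShadow_triple_le (hk : 3 ≤ k) (hs : 1 ≤ s) {A B C : Finset α}
    (hAB : A ≠ B) (hA : #A = k + s) (hB : #B = k + s) (hC : #C = k + s) (hAC : A ≠ C)
    (hBC : B ≠ C) (h : #(kShadow k {A, B, C}) ≤ tripleShadow k s) :
    #(A ∪ B) = k + s + 1 ∧ C ⊆ A ∪ B := by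
  have key : ∀ D ∈ ({A, B, C} : Finset (Finset α)), #D = k + s := by simp [hA, hB, hC]
  have hc2 : #({A, B} : Finset (Finset α)) = 2 := card_pair hAB
  have hc3 : #({A, B, C} : Finset (Finset α)) = 3 := card_eq_three.2 ⟨A, B, C, hAB, hAC, hBC, rfl⟩
  have h2 := card_kShadow_add_sum_le (k := k) (ℬ := {A, B}) key
    (by intro; simp; tauto) (by omega)
  rw [hc2, hc3, Nat.Ico_succ_singleton, sum_singleton] at h2
  rw [tripleShadow] at h
  refine ⟨card_union_of_card_kShadow_pair_le (by omega) hs hAB hA hB (by omega), ?_⟩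
  intro c hc
  by_contra hcn
  rw [mem_union, not_or] at hcn
  have h3 := card_kShadow_add_le_card_kShadow_insert (k := k) (s := s) (𝒜 := {A, B}) (j := 1)
    (T := {c}) hC (by simpa using hc) (by simp) (by omega) (by simpa using hcn)
  have e : insert C {A, B} = ({A, B, C} : Finset (Finset α)) := by
    ext; simp; tauto
  rw [e] at h3
  have h4 := card_kShadow_add_sum_le (k := k) (s := s) (ℬ := ∅) (𝒜 := {A, B})
    (by simp [hA, hB]) (by simp) (by omega)
  rw [hc2, card_empty, ← range_eq_Ico] at h4
  simp [sum_range_succ] at h4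
  obtain ⟨m, hm⟩ : ∃ m, k + s = m + 2 := ⟨k + s - 2, by omega⟩
  obtain ⟨s, rfl⟩ : ∃ c, s = c + 1 := ⟨s - 1, by omega⟩
  rw [hm] at h3 h4 h
  have p2 := Nat.choose_succ_succ m s
  have p3 : 0 < m.choose s := Nat.choose_pos (by omega)
  simp only [Nat.succ_eq_add_one, show m + 2 - 1 = m + 1 by omega, Nat.add_sub_cancel] at *
  omega

lemma exists_card_eq_forall_subset (hk : 4 ≤ k) (hs : 1 ≤ s) (h𝒜 : ∀ A ∈ 𝒜, #A = k + s)
    (hcard : #𝒜 = 3 ∨ k = 4 ∧ #𝒜 = k + s + 1)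
    (heq : tripleShadow k s + #𝒜 = #(kShadow k 𝒜) + 3) :
    ∃ U, #U = k + s + 1 ∧ ∀ A ∈ 𝒜, A ⊆ U := by
  have htriple : ∀ A ∈ 𝒜, ∀ B ∈ 𝒜, ∀ C ∈ 𝒜, A ≠ B → A ≠ C → B ≠ C →
      #(kShadow k {A, B, C}) ≤ tripleShadow k s := by
    intro A hA B hB C hC hAB hAC hBC
    have hsub : ({A, B, C} : Finset (Finset α)) ⊆ 𝒜 := by simp [insert_subset_iff, *]
    have hc3 : #({A, B, C} : Finset (Finset α)) = 3 :=
      card_eq_three.2 ⟨A, B, C, hAB, hAC, hBC, rfl⟩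
    obtain h3 | ⟨rfl, h4⟩ := hcard
    · rw [eq_of_subset_of_card_le hsub (by omega)]
      omega
    · obtain ⟨ℬ, hℬ, hℬ𝒜, hℬc⟩ := exists_subsuperset_card_eq (n := 5) hsub (by omega) (by omega)
      have h := card_kShadow_add_sum_le (k := 4) (s := s) (fun A hA => h𝒜 A (hℬ𝒜 hA)) hℬ
        (by omega)
      have h5 := card_le_card (kShadow_mono (k := 4) hℬ𝒜)
      have h6 := sum_range_choose_sub 4 s
      have h7 := choose_eq_tripleShadow_add (k := 4) (s := s) (by omega)
      rw [show 4 + s - 2 = s + 1 + 1 by omega, Nat.choose_succ_self_right] at h7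
      rw [range_eq_Ico, ← sum_Ico_consecutive _ (Nat.zero_le 3) (by omega), ← range_eq_Ico,
        tripleShadow_eq_sum] at h6
      rw [hc3, hℬc] at h
      simp only [Nat.reduceAdd] at h6
      omega
  obtain ⟨𝒯, h𝒯, hc⟩ := exists_subset_card_eq (show 3 ≤ #𝒜 by omega)
  obtain ⟨A, B, C, hAB, hAC, hBC, rfl⟩ := card_eq_three.1 hc
  simp only [insert_subset_iff, singleton_subset_iff] at h𝒯
  obtain ⟨hA, hB, hC⟩ := h𝒯
  have H : ∀ D ∈ 𝒜, A ≠ D → B ≠ D → #(A ∪ B) = k + s + 1 ∧ D ⊆ A ∪ B := fun D hD hAD hBD =>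
    subset_union_of_card_kShadow_triple_le (by omega) hs hAB (h𝒜 A hA) (h𝒜 B hB) (h𝒜 D hD) hAD hBD
      (htriple A hA B hB D hD hAB hAD hBD)
  refine ⟨A ∪ B, (H C hC hAC hBC).1, fun D hD => ?_⟩
  obtain rfl | hAD := eq_or_ne A D
  · exact subset_union_left
  obtain rfl | hBD := eq_or_ne B D
  · exact subset_union_right
  exact (H D hD hAD hBD).2

end SmallFamilies

section LocalLYM

variable {α : Type*} [DecidableEq α] {r s : ℕ} {𝒜 : Finset (Finset α)} {X : Finset α}

/-- Iterated form of the local LYM inequality. -/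
lemma card_mul_choose_le_card_kShadow_mul_choose (h𝒜 : 𝒜 ⊆ powersetCard (r + s) X) :
    #𝒜 * (r + s).choose s ≤ #(kShadow r 𝒜) * (#X - r).choose s := by
  refine card_mul_le_card_mul (fun A K => K ⊆ A) (fun A hA => ?_) fun K hK => ?_
  · rw [← Nat.choose_symm_add, ← (mem_powersetCard.1 (h𝒜 hA)).2, ← card_powersetCard]
    refine card_le_card fun K hK => ?_
    rw [mem_powersetCard] at hK
    exact (mem_bipartiteAbove _).2 ⟨mem_kShadow.2 ⟨A, hA, hK⟩, hK.1⟩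
  · obtain ⟨A, hA, hKA, rfl⟩ := mem_kShadow.1 hK
    have h := card_filter_superset_powersetCard (k := #K + s)
      (hKA.trans (mem_powersetCard.1 (h𝒜 hA)).1) (by omega)
    rw [Nat.add_sub_cancel_left] at h
    rw [← h]
    exact card_le_card fun B hB => mem_filter.2 ⟨h𝒜 (mem_filter.1 hB).1, (mem_filter.1 hB).2⟩

lemma card_le_card_kShadow (h𝒜 : 𝒜 ⊆ powersetCard (r + s) X) (hX : #X ≤ 2 * r + s) :
    #𝒜 ≤ #(kShadow r 𝒜) ∧
      (1 ≤ s → #X < 2 * r + s → 𝒜.Nonempty → #𝒜 < #(kShadow r 𝒜)) := by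
  have h := card_mul_choose_le_card_kShadow_mul_choose h𝒜
  have hpos : 0 < (r + s).choose s := Nat.choose_pos (by omega)
  refine ⟨?_, fun hs hX hne => ?_⟩
  · have h2 : (#X - r).choose s ≤ (r + s).choose s := Nat.choose_le_choose _ (by omega)
    exact Nat.le_of_mul_le_mul_right (h.trans (Nat.mul_le_mul_left _ h2)) hpos
  · obtain ⟨s, rfl⟩ : ∃ c, s = c + 1 := ⟨s - 1, by omega⟩
    have h2 : (#X - r).choose (s + 1) ≤ (r + s).choose (s + 1) :=
      Nat.choose_le_choose _ (by omega)
    have h3 : (r + s + 1).choose (s + 1) = (r + s).choose s + (r + s).choose (s + 1) :=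
      Nat.choose_succ_succ _ _
    have h4 : 0 < (r + s).choose s := Nat.choose_pos (by omega)
    have h5 := card_pos.2 hne
    by_contra! h6
    rw [← add_assoc, h3] at h
    have := h.trans (Nat.mul_le_mul h6 h2)
    nlinarith

end LocalLYM

section InitSeg

variable {N m : ℕ} {𝒞 : Finset (Finset (Fin N))} {y : Fin N}

lemma exists_isInitSeg_card_eq {a : ℕ} (h : a ≤ N.choose m) :
    ∃ 𝒞 : Finset (Finset (Fin N)), Colex.IsInitSeg 𝒞 m ∧ #𝒞 = a := by
  induction a with
  | zero => exact ⟨∅, Colex.isInitSeg_empty, rfl⟩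
  | succ a ih =>
    obtain ⟨𝒞, h𝒞, rfl⟩ := ih (by omega)
    have hne : (powersetCard m univ \ 𝒞).Nonempty := by
      rw [← card_pos]
      have := le_card_sdiff 𝒞 (powersetCard m (univ : Finset (Fin N)))
      rw [card_powersetCard, card_univ, Fintype.card_fin] at this
      omega
    obtain ⟨A, hA, hmin⟩ := exists_min_image _ toColex hne
    simp only [mem_sdiff, mem_powersetCard, subset_univ, true_and] at hA hmin
    refine ⟨insert A 𝒞, ⟨?_, ?_⟩, card_insert_of_notMem hA.2⟩
    · intro B hB
      obtain rfl | hB := mem_insert.1 (mem_coe.1 hB)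
      exacts [hA.1, h𝒞.1 hB]
    · rintro S T hS ⟨hlt, hT⟩
      obtain rfl | hS := mem_insert.1 hS
      · by_contra hT'
        exact (hmin T ⟨hT, fun h => hT' (mem_insert_of_mem h)⟩).not_gt hlt
      · exact mem_insert_of_mem (h𝒞.2 hS ⟨hlt, hT⟩)

lemma powersetCard_Iio_subset (h𝒞 : Colex.IsInitSeg 𝒞 m) (h : (y : ℕ).choose m ≤ #𝒞) :
    powersetCard m (Iio y) ⊆ 𝒞 := by
  intro A hA
  by_contra hA𝒞
  have hsub : 𝒞 ⊆ powersetCard m (Iio y) := by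
    intro B hB
    refine mem_powersetCard.2 ⟨?_, h𝒞.1 hB⟩
    have hle : toColex B ≤ toColex A := by
      by_contra! hlt
      exact hA𝒞 (h𝒞.2 hB ⟨hlt, (mem_powersetCard.1 hA).2⟩)
    intro b hb
    exact mem_Iio.2 (Colex.forall_lt_mono hle (fun c hc => mem_Iio.1 ((mem_powersetCard.1 hA).1 hc))
      b hb)
  have hss : 𝒞 ⊂ powersetCard m (Iio y) := ⟨hsub, fun h' => hA𝒞 (h' hA)⟩
  have := card_lt_card hss
  rw [card_powersetCard, Fin.card_Iio] at this
  omega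

lemma subset_powersetCard_Iic (h𝒞 : Colex.IsInitSeg 𝒞 m) (h : #𝒞 ≤ (y + 1 : ℕ).choose m) :
    𝒞 ⊆ powersetCard m (Iic y) := by
  intro A hA
  refine mem_powersetCard.2 ⟨?_, h𝒞.1 hA⟩
  by_contra hAy
  have hsub : powersetCard m (Iic y) ⊂ 𝒞 := by
    refine ⟨fun B hB => ?_, fun h' => hAy (mem_powersetCard.1 (h' hA)).1⟩
    refine h𝒞.2 hA ⟨?_, (mem_powersetCard.1 hB).2⟩
    by_contra! hle
    exact hAy fun b hb => mem_Iic.2 (Colex.forall_le_mono hle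
      (fun c hc => mem_Iic.1 ((mem_powersetCard.1 hB).1 hc)) b hb)
  have := card_lt_card hsub
  rw [card_powersetCard, Fin.card_Iic] at this
  omega

lemma card_add_choose_le_of_isInitSeg {k s : ℕ} (h𝒞 : Colex.IsInitSeg 𝒞 (k + 1 + s))
    (hmy : k + 1 + s ≤ y) (hy : (y : ℕ) ≤ 2 * k + s) (h1 : (y : ℕ).choose (k + 1 + s) ≤ #𝒞)
    (h2 : #𝒞 ≤ (y + 1 : ℕ).choose (k + 1 + s)) :
    #𝒞 + (y : ℕ).choose (k + 1) ≤ #(kShadow (k + 1) 𝒞) + (y : ℕ).choose (k + 1 + s) ∧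
      (1 ≤ s → (y : ℕ) < 2 * k + s → (y : ℕ).choose (k + 1 + s) < #𝒞 →
        #𝒞 + (y : ℕ).choose (k + 1) < #(kShadow (k + 1) 𝒞) + (y : ℕ).choose (k + 1 + s)) := by
  have hIio := powersetCard_Iio_subset h𝒞 h1
  have hIic := subset_powersetCard_Iic h𝒞 h2
  set 𝒟 := {B ∈ powersetCard (k + s) (Iio y) | insert y B ∈ 𝒞} with h𝒟
  have hy𝒟 : ∀ B ∈ 𝒟, B ⊆ Iio y := fun B hB => (mem_powersetCard.1 (mem_filter.1 hB).1).1
  have hinj : ∀ 𝒮 : Finset (Finset (Fin N)), (∀ B ∈ 𝒮, B ⊆ Iio y) →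
      #(𝒮.image (insert y)) = #𝒮 := by
    refine fun 𝒮 h => card_image_of_injOn fun B hB C hC hBC => ?_
    have hn : ∀ B ∈ 𝒮, y ∉ B := fun B hB hyB => (mem_Iio.1 (h B hB hyB)).ne rfl
    rw [← erase_insert (hn B hB), ← erase_insert (hn C hC)]
    exact congrArg (fun S => S.erase y) hBC
  have hdisj : ∀ (j : ℕ) (𝒮 : Finset (Finset (Fin N))),
      Disjoint (powersetCard j (Iio y)) (𝒮.image (insert y)) := by
    refine fun j 𝒮 => disjoint_left.2 fun B hB hB' => ?_
    obtain ⟨C, -, rfl⟩ := mem_image.1 hB'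
    exact (mem_Iio.1 ((mem_powersetCard.1 hB).1 (mem_insert_self _ _))).ne rfl
  have hcard : #𝒞 = (y : ℕ).choose (k + 1 + s) + #𝒟 := by
    rw [← hinj 𝒟 hy𝒟, ← Fin.card_Iio, ← card_powersetCard, ← card_union_of_disjoint (hdisj _ _)]
    congr 1
    ext A
    simp only [mem_union, mem_image]
    constructor
    · intro hA
      obtain ⟨hAy, hAc⟩ := mem_powersetCard.1 (hIic hA)
      by_cases hyA : y ∈ A
      · refine Or.inr ⟨A.erase y, mem_filter.2 ⟨mem_powersetCard.2 ⟨fun b hb => ?_, ?_⟩, ?_⟩,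
          insert_erase hyA⟩
        · rw [mem_erase] at hb
          exact mem_Iio.2 (lt_of_le_of_ne (mem_Iic.1 (hAy hb.2)) hb.1)
        · rw [card_erase_of_mem hyA]
          omega
        · rwa [insert_erase hyA]
      · refine Or.inl (mem_powersetCard.2 ⟨fun b hb => ?_, hAc⟩)
        exact mem_Iio.2 (lt_of_le_of_ne (mem_Iic.1 (hAy hb)) fun h => hyA (h ▸ hb))
    · rintro (hA | ⟨B, hB, rfl⟩)
      · exact hIio hA
      · exact (mem_filter.1 hB).2
  have hshadow : (y : ℕ).choose (k + 1) + #(kShadow k 𝒟) ≤ #(kShadow (k + 1) 𝒞) := by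
    have hy𝒟' : ∀ B ∈ kShadow k 𝒟, B ⊆ Iio y := by
      intro B hB
      obtain ⟨A, hA, hBA, -⟩ := mem_kShadow.1 hB
      exact hBA.trans (hy𝒟 A hA)
    rw [← hinj _ hy𝒟', ← Fin.card_Iio, ← card_powersetCard, ← card_union_of_disjoint (hdisj _ _)]
    refine card_le_card (union_subset (fun K hK => ?_) fun K hK => ?_)
    · rw [mem_powersetCard] at hK
      obtain ⟨A, hKA, hA, hAc⟩ := exists_subsuperset_card_eq hK.1 (show #K ≤ k + 1 + s by omega)
        (by rwa [Fin.card_Iio])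
      exact mem_kShadow.2 ⟨A, hIio (mem_powersetCard.2 ⟨hA, hAc⟩), hKA, hK.2⟩
    · obtain ⟨B, hB, rfl⟩ := mem_image.1 hK
      obtain ⟨A, hA, hBA, hBc⟩ := mem_kShadow.1 hB
      refine mem_kShadow.2 ⟨insert y A, (mem_filter.1 hA).2, insert_subset_insert _ hBA, ?_⟩
      rw [card_insert_of_notMem fun hyB => (mem_Iio.1 (hy𝒟' B hB hyB)).ne rfl, hBc]
  have h𝒟sub : 𝒟 ⊆ powersetCard (k + s) (Iio y) := filter_subset _ _
  have h := card_le_card_kShadow h𝒟sub (by rw [Fin.card_Iio]; exact hy)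
  rw [Fin.card_Iio] at h
  refine ⟨by omega, fun hs hlt hpos => ?_⟩
  have := h.2 hs hlt (card_pos.1 (by omega))
  omega

end InitSeg

lemma card_add_choose_le_card_kShadow {k s x : ℕ} {𝒜 : Finset (Finset ℕ)}
    (h𝒜 : ∀ A ∈ 𝒜, #A = k + 1 + s) (hmx : k + 1 + s ≤ x)
    (hx : x ≤ 2 * k + s) (h1 : x.choose (k + 1 + s) ≤ #𝒜)
    (h2 : #𝒜 ≤ (x + 1).choose (k + 1 + s)) :
    #𝒜 + x.choose (k + 1) ≤ #(kShadow (k + 1) 𝒜) + x.choose (k + 1 + s) ∧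
      (1 ≤ s → x < 2 * k + s → x.choose (k + 1 + s) < #𝒜 →
        #𝒜 + x.choose (k + 1) < #(kShadow (k + 1) 𝒜) + x.choose (k + 1 + s)) := by
  obtain ⟨N, hxN, hN⟩ : ∃ N, x < N ∧ ∀ A ∈ 𝒜, ∀ a ∈ A, a < N :=
    ⟨x + 1 + (𝒜.biUnion id).sup id + 1, by omega, fun A hA a ha => by
      have := le_sup (f := id) (mem_biUnion.2 ⟨A, hA, ha⟩ : a ∈ 𝒜.biUnion id)
      simp only [id] at this ⊢
      omega⟩
  set ℬ : Finset (Finset (Fin N)) := {B | B.map Fin.valEmbedding ∈ 𝒜} with hℬ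
  have hmemℬ : ∀ B, B ∈ ℬ ↔ B.map Fin.valEmbedding ∈ 𝒜 := by simp [hℬ]
  have hcard : #ℬ = #𝒜 := by
    rw [← card_map (mapEmbedding Fin.valEmbedding).toEmbedding]
    congr 1
    ext A
    simp only [mem_map, hmemℬ]
    refine ⟨?_, fun hA => ⟨A.attachFin (hN A hA), ?_⟩⟩
    · rintro ⟨B, hB, rfl⟩
      exact hB
    · have : (A.attachFin (hN A hA)).map Fin.valEmbedding = A := by simp
      exact ⟨this.symm ▸ hA, this⟩
  have hsized : ∀ B ∈ ℬ, #B = k + 1 + s := fun B hB => by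
    rw [← h𝒜 _ ((hmemℬ B).1 hB), card_map]
  have hsh : #(kShadow (k + 1) ℬ) ≤ #(kShadow (k + 1) 𝒜) := by
    rw [← card_map (mapEmbedding Fin.valEmbedding).toEmbedding]
    refine card_le_card fun K hK => ?_
    obtain ⟨L, hL, rfl⟩ := mem_map.1 hK
    obtain ⟨B, hB, hLB, hLc⟩ := mem_kShadow.1 hL
    exact mem_kShadow.2 ⟨_, (hmemℬ B).1 hB, map_subset_map.2 hLB, by simpa using hLc⟩
  have hle : #ℬ ≤ N.choose (k + 1 + s) := by
    have : ℬ ⊆ powersetCard (k + 1 + s) univ :=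
      fun B hB => mem_powersetCard.2 ⟨subset_univ _, hsized B hB⟩
    simpa using card_le_card this
  obtain ⟨𝒞, h𝒞, h𝒞c⟩ := exists_isInitSeg_card_eq hle
  have hkk := iterated_kk (k := s) (fun B hB => hsized B hB) h𝒞c.le h𝒞
  rw [← kShadow_eq_shadow_iterate hsized, ← kShadow_eq_shadow_iterate fun B hB => h𝒞.1 hB] at hkk
  have := card_add_choose_le_of_isInitSeg (y := ⟨x, hxN⟩) h𝒞 hmx hx
    (by rw [h𝒞c, hcard]; exact h1) (by rw [h𝒞c, hcard]; exact h2)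
  simp only at this
  omega

section Shifting

/-- A family of sets of naturals is shifted if replacing an element of a member by a smaller one
yields a member. -/
def IsShifted (𝒜 : Finset (Finset ℕ)) : Prop :=
  ∀ A ∈ 𝒜, ∀ i j, i < j → j ∈ A → i ∉ A → insert i (A.erase j) ∈ 𝒜

variable {α : Type*} [DecidableEq α] {𝒜 : Finset (Finset α)} {A B : Finset α} {c s : ℕ} {i j : α}

lemma compress_singleton_of_mem (hj : j ∈ A) (hi : i ∉ A) :
    UV.compress {i} {j} A = insert i (A.erase j) := by
  rw [UV.compress_of_disjoint_of_le (by simpa using hi) (by simpa using hj)]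
  ext x
  simp only [sup_eq_union, mem_sdiff, mem_union, mem_singleton, mem_insert, mem_erase]
  grind

lemma compress_singleton_of_not (h : ¬ (j ∈ A ∧ i ∉ A)) : UV.compress {i} {j} A = A := by
  unfold UV.compress
  rw [if_neg]
  simpa [and_comm] using h

lemma card_insert_inter_erase (hj : j ∈ A ∩ B) (hi : i ∉ A ∩ B) :
    #(insert i ((A ∩ B).erase j)) = #(A ∩ B) := by
  rw [card_insert_of_notMem (fun h => hi (mem_of_mem_erase h)), card_erase_add_one hj]

lemma le_card_inter_of_mem_compression
    (hint : ∀ A ∈ 𝒜, ∀ B ∈ 𝒜, c ≤ #(A ∩ B)) :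
    ∀ A ∈ UV.compression {i} {j} 𝒜, ∀ B ∈ UV.compression {i} {j} 𝒜, c ≤ #(A ∩ B) := by
  have new : ∀ B, B ∉ 𝒜 ∧ (∃ C ∈ 𝒜, UV.compress {i} {j} C = B) →
      ∃ C ∈ 𝒜, j ∈ C ∧ i ∉ C ∧ B = insert i (C.erase j) := by
    rintro B ⟨hB, C, hC, rfl⟩
    by_cases h : j ∈ C ∧ i ∉ C
    · exact ⟨C, hC, h.1, h.2, compress_singleton_of_mem h.1 h.2⟩
    · rw [compress_singleton_of_not h] at hB
      exact absurd hC hB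
  have mixed : ∀ A, A ∈ 𝒜 ∧ UV.compress {i} {j} A ∈ 𝒜 → ∀ C ∈ 𝒜, j ∈ C → i ∉ C →
      c ≤ #(A ∩ insert i (C.erase j)) := by
    rintro A ⟨hA, hA'⟩ C hC hjC hiC
    by_cases hjA : j ∈ A
    · by_cases hiA : i ∈ A
      · have e : A ∩ insert i (C.erase j) = insert i ((A ∩ C).erase j) := by grind
        rw [e, card_insert_inter_erase (by simp [*]) (by simp [*])]
        exact hint A hA C hC
      · rw [compress_singleton_of_mem hjA hiA] at hA'
        have e : A ∩ insert i (C.erase j) = insert i (A.erase j) ∩ C := by grind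
        rw [e]
        exact hint _ hA' C hC
    · exact (hint A hA C hC).trans (card_le_card (by grind))
  intro A hA B hB
  rw [UV.mem_compression] at hA hB
  obtain hA | hA := hA
  · obtain hB | hB := hB
    · exact hint A hA.1 B hB.1
    · obtain ⟨C, hC, hjC, hiC, rfl⟩ := new B hB
      exact mixed A hA C hC hjC hiC
  · obtain ⟨D, hD, hjD, hiD, rfl⟩ := new A hA
    obtain hB | hB := hB
    · rw [inter_comm]
      exact mixed B hB D hD hjD hiD
    · obtain ⟨C, hC, hjC, hiC, rfl⟩ := new B hB
      rw [← insert_inter_distrib, erase_inter, inter_erase, erase_idem,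
        card_insert_inter_erase (by simp [*]) (by simp [*])]
      exact hint D hD C hC

lemma shadow_iterate_compression_singleton_subset :
    shadow^[s] (UV.compression {i} {j} 𝒜) ⊆ UV.compression {i} {j} (shadow^[s] 𝒜) := by
  induction s generalizing 𝒜 with
  | zero => exact le_rfl
  | succ s ih =>
    rw [Function.iterate_succ_apply', Function.iterate_succ_apply']
    refine (shadow_monotone ih).trans (UV.shadow_compression_subset_compression_shadow _ _ ?_)
    intro x hx
    refine ⟨j, mem_singleton_self j, ?_⟩
    rw [mem_singleton.1 hx, erase_singleton, erase_singleton]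
    exact UV.isCompressed_self _ _

lemma sum_compression_lt {𝒜 : Finset (Finset ℕ)} {i j : ℕ} (hij : i < j) {A : Finset ℕ} (hA : A ∈ 𝒜)
    (hjA : j ∈ A) (hiA : i ∉ A) (hn : insert i (A.erase j) ∉ 𝒜) :
    ∑ B ∈ UV.compression {i} {j} 𝒜, ∑ x ∈ B, x < ∑ B ∈ 𝒜, ∑ x ∈ B, x := by
  rw [UV.compression, sum_union UV.compress_disjoint, filter_image, sum_image UV.compress_injOn,
    ← sum_filter_add_sum_filter_not 𝒜 (fun B => UV.compress {i} {j} B ∈ 𝒜)]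
  refine add_lt_add_of_le_of_lt le_rfl (sum_lt_sum_of_nonempty ⟨A, ?_⟩ fun B hB => ?_)
  · exact mem_filter.2 ⟨hA, by rwa [compress_singleton_of_mem hjA hiA]⟩
  · rw [mem_filter] at hB
    have h : j ∈ B ∧ i ∉ B := by
      by_contra h
      exact hB.2 (by rw [compress_singleton_of_not h]; exact hB.1)
    rw [compress_singleton_of_mem h.1 h.2, sum_insert fun hi => h.2 (mem_of_mem_erase hi),
      ← add_sum_erase B (fun x => x) h.1]
    omega

lemma exists_isShifted {k : ℕ} (𝒜 : Finset (Finset ℕ)) (h𝒜 : ∀ A ∈ 𝒜, #A = k + s)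
    (hint : ∀ A ∈ 𝒜, ∀ B ∈ 𝒜, c ≤ #(A ∩ B)) :
    ∃ ℬ : Finset (Finset ℕ), IsShifted ℬ ∧ (∀ A ∈ ℬ, #A = k + s) ∧
      (∀ A ∈ ℬ, ∀ B ∈ ℬ, c ≤ #(A ∩ B)) ∧ #ℬ = #𝒜 ∧ #(kShadow k ℬ) ≤ #(kShadow k 𝒜) := by
  induction hw : ∑ B ∈ 𝒜, ∑ x ∈ B, x using Nat.strong_induction_on generalizing 𝒜 with
  | h w ih =>
    by_cases hsh : IsShifted 𝒜
    · exact ⟨𝒜, hsh, h𝒜, hint, rfl, le_rfl⟩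
    unfold IsShifted at hsh
    push Not at hsh
    obtain ⟨A, hA, i, j, hij, hjA, hiA, hn⟩ := hsh
    have hsized : ∀ B ∈ UV.compression {i} {j} 𝒜, #B = k + s := fun B hB =>
      Set.Sized.uvCompression (by simp) (fun _ h => h𝒜 _ h) hB
    obtain ⟨ℬ, h1, h2, h3, h4, h5⟩ := ih _ (hw ▸ sum_compression_lt hij hA hjA hiA hn) _ hsized
      (le_card_inter_of_mem_compression hint) rfl
    refine ⟨ℬ, h1, h2, h3, h4.trans (UV.card_compression _ _ _), h5.trans ?_⟩
    rw [kShadow_eq_shadow_iterate hsized, kShadow_eq_shadow_iterate h𝒜,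
      ← UV.card_compression {i} {j} (shadow^[s] 𝒜)]
    exact card_le_card shadow_iterate_compression_singleton_subset

end Shifting

section Walk

/-- Position after `j` steps of the walk that goes up at `x` when `x ∈ A` and down otherwise. -/
def walk (A : Finset ℕ) (j : ℕ) : ℤ := 2 * #(A ∩ range j) - j

/-- `j` is the last time at which the walk of `A` is at height at least `v`. -/
def IsLastVisit (A : Finset ℕ) (v : ℤ) (j : ℕ) : Prop :=
  v ≤ walk A j ∧ ∀ l, j < l → walk A l < v

variable {A B L : Finset ℕ} {𝒜 : Finset (Finset ℕ)} {c k r s i j : ℕ} {v : ℤ}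

lemma IsLastVisit.unique (hi : IsLastVisit A v i) (hj : IsLastVisit A v j) : i = j := by
  obtain h | h | h := lt_trichotomy i j
  · exact absurd hj.1 (hi.2 j h).not_ge
  · exact h
  · exact absurd hi.1 (hj.2 i h).not_ge

lemma IsLastVisit.walk_eq (h : IsLastVisit A v j) : walk A j = v := by
  have h1 := h.1
  have h2 := h.2 (j + 1) (Nat.lt_succ_self j)
  have h3 : #(A ∩ range j) ≤ #(A ∩ range (j + 1)) := card_le_card (by gcongr; simp)
  simp only [walk] at *
  push_cast at h2
  omega

lemma exists_isLastVisit (h : v ≤ walk A j) : ∃ l, IsLastVisit A v l := by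
  have hb : ∀ l, v ≤ walk A l → (l : ℤ) ≤ 2 * #A - v := by
    intro l hl
    have : #(A ∩ range l) ≤ #A := card_le_card inter_subset_left
    simp only [walk] at hl
    omega
  classical
  have hfin : {l | v ≤ walk A l}.Finite :=
    (Set.finite_Iic (2 * #A - v).toNat).subset fun l hl => by
      have := hb l hl
      rw [Set.mem_Iic]
      omega
  obtain ⟨l, hl, hmax⟩ := hfin.exists_maximal ⟨j, h⟩
  refine ⟨l, hl, fun m hm => ?_⟩
  by_contra! hvm
  exact (hmax hvm hm.le).not_gt hm

lemma card_inter_range_add (A B : Finset ℕ) (j : ℕ) :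
    #(A ∩ range j) + #(B ∩ range j) = #((A ∪ B) ∩ range j) + #(A ∩ B ∩ range j) := by
  rw [← card_union_add_card_inter, ← union_inter_distrib_right, ← inter_inter_distrib_right]

/-- Two members of a shifted `c`-intersecting family have a common prefix in which they have at
least `c` more elements in total than its length. -/
lemma IsShifted.exists_le_card_inter_range_add (h𝒜 : IsShifted 𝒜) (hc : 1 ≤ c)
    (hint : ∀ A ∈ 𝒜, ∀ B ∈ 𝒜, c ≤ #(A ∩ B)) (hA : A ∈ 𝒜) (hB : B ∈ 𝒜) :
    ∃ j, j + c ≤ #(A ∩ range j) + #(B ∩ range j) := by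
  by_contra! hlt
  induction hd : #(A ∩ B) using Nat.strong_induction_on generalizing A with
  | h d ih =>
  have hex : ∃ q, c ≤ #(A ∩ B ∩ range q) := by
    refine ⟨(A ∩ B).sup id + 1, (hint A hA B hB).trans (card_le_card fun x hx => ?_)⟩
    exact mem_inter.2 ⟨hx, mem_range_succ_iff.2 (le_sup (f := id) hx)⟩
  obtain ⟨q, hq, hmin⟩ : ∃ q, c ≤ #(A ∩ B ∩ range q) ∧ ∀ p < q, #(A ∩ B ∩ range p) < c := by
    classical
    exact ⟨Nat.find hex, Nat.find_spec hex, fun p hp => not_le.1 (Nat.find_min hex hp)⟩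
  obtain _ | p := q
  · simp at hq
    omega
  have hp : p ∈ A ∩ B := by
    by_contra hp
    have := hmin p (Nat.lt_succ_self p)
    rw [range_add_one, inter_insert_of_notMem hp] at hq
    omega
  have hmiss : ∃ i < p, i ∉ A ∪ B := by
    by_contra! hall
    have hsub : range (p + 1) ⊆ (A ∪ B) ∩ range (p + 1) := by
      intro i hi
      refine mem_inter.2 ⟨?_, hi⟩
      obtain h | rfl := Nat.lt_succ_iff_lt_or_eq.1 (mem_range.1 hi)
      · exact hall i h
      · exact inter_subset_union hp
    have h1 := card_le_card hsub
    have h2 := card_inter_range_add A B (p + 1)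
    have h3 := hlt (p + 1)
    rw [card_range] at h1
    omega
  obtain ⟨i, hip, hi⟩ := hmiss
  rw [mem_union, not_or] at hi
  rw [mem_inter] at hp
  refine ih #(insert i (A.erase p) ∩ B) ?_ (h𝒜 A hA i p hip hp.1 hi.1) (fun j => ?_) rfl
  · rw [← hd]
    exact card_lt_card ⟨by grind, fun h => by
      have := h (mem_inter.2 hp)
      grind⟩
  · have hj := hlt j
    obtain hji | hij := Nat.lt_or_ge i j
    · obtain hjp | hpj := Nat.lt_or_ge p j
      · have e : insert i (A.erase p) ∩ range j = insert i ((A ∩ range j).erase p) := by grind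
        rw [e, card_insert_of_notMem (by grind), card_erase_add_one (by grind)]
        exact hj
      · have h1 := hmin j (by omega)
        have h2 := card_inter_range_add A B j
        have h3 : #((A ∪ B) ∩ range j) < j := by
          conv_rhs => rw [← card_range j]
          exact card_lt_card ⟨inter_subset_right, fun h => by
            have := h (mem_range.2 hji)
            grind⟩
        have h4 : #(insert i (A.erase p) ∩ range j) ≤ #(A ∩ range j) + 1 :=
          (card_le_card (by grind : _ ⊆ insert i (A ∩ range j))).trans (card_insert_le _ _)
        omega
    · have : insert i (A.erase p) ∩ range j ⊆ A ∩ range j := by grind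
      have := card_le_card this
      omega

lemma IsShifted.exists_isLastVisit (h𝒜 : IsShifted 𝒜)
    (hint : ∀ A ∈ 𝒜, ∀ B ∈ 𝒜, s + 1 ≤ #(A ∩ B)) (hA : A ∈ 𝒜) :
    ∃ j, IsLastVisit A (s + 1) j := by
  obtain ⟨j, hj⟩ := h𝒜.exists_le_card_inter_range_add (by omega) hint hA hA
  refine _root_.exists_isLastVisit (j := j) ?_
  simp only [walk]
  omega

lemma IsLastVisit.of_subset (h : IsLastVisit A (s + 1) j) (hL : L ⊆ A ∩ range j)
    (hc : #L + s = #(A ∩ range j)) : IsLastVisit (L ∪ A \ range j) (1 - s) j := by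
  have hw := h.walk_eq
  have key : ∀ l, j ≤ l → walk (L ∪ A \ range j) l = walk A l - 2 * s := by
    intro l hl
    have e1 : (L ∪ A \ range j) ∩ range l = L ∪ (A \ range j) ∩ range l := by grind
    have e2 : A ∩ range l = (A ∩ range j) ∪ (A \ range j) ∩ range l := by grind
    have d2 : Disjoint (A ∩ range j) ((A \ range j) ∩ range l) := by
      rw [disjoint_left]
      grind
    simp only [walk]
    rw [e1, e2, card_union_of_disjoint d2, card_union_of_disjoint (d2.mono_left hL)]
    omega
  refine ⟨by rw [key j le_rfl]; omega, fun l hl => ?_⟩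
  have := h.2 l hl
  rw [key l hl.le]
  omega

end Walk

section KatonaShadow

variable {𝒜 : Finset (Finset ℕ)} {k s j : ℕ} {T : Finset ℕ}

/-- The `k`-subsets obtained by shrinking the parts below `j` of members of `𝒜`, for a family `𝒜`
whose members have the common tail `T` and last visit height `s + 1` at time `j`. -/
def lowered (s j : ℕ) (T : Finset ℕ) (𝒜 : Finset (Finset ℕ)) : Finset (Finset ℕ) :=
  (kShadow ((j + 1 - s) / 2) (𝒜.image (· ∩ range j))).image (· ∪ T)

lemma exists_of_mem_lowered (h𝒜 : ∀ A ∈ 𝒜, #A = k + s ∧ IsLastVisit A (s + 1) j ∧ A \ range j = T)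
    {K : Finset ℕ} (hK : K ∈ lowered s j T 𝒜) :
    K ∈ kShadow k 𝒜 ∧ IsLastVisit K (1 - s) j ∧ K \ range j = T := by
  obtain ⟨L, hL, rfl⟩ := mem_image.1 hK
  obtain ⟨H, hH, hLH, hLc⟩ := mem_kShadow.1 hL
  obtain ⟨A, hA, rfl⟩ := mem_image.1 hH
  obtain ⟨hAc, hlast, rfl⟩ := h𝒜 A hA
  have hw := hlast.walk_eq
  have h1 : #(A ∩ range j) ≤ j := (card_le_card inter_subset_right).trans (card_range j).le
  have h2 := card_inter_add_card_sdiff A (range j)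
  simp only [walk] at hw
  have hdisj : Disjoint L (A \ range j) := by
    rw [disjoint_left]
    grind
  refine ⟨mem_kShadow.2 ⟨A, hA, by grind, ?_⟩, hlast.of_subset hLH (by omega), by grind⟩
  rw [card_union_of_disjoint hdisj]
  omega

lemma mul_card_le_mul_card_lowered
    (h𝒜 : ∀ A ∈ 𝒜, #A = k + s ∧ IsLastVisit A (s + 1) j ∧ A \ range j = T) :
    (k + s) * #𝒜 ≤ k * #(lowered s j T 𝒜) := by
  obtain rfl | ⟨A₀, hA₀⟩ := 𝒜.eq_empty_or_nonempty
  · simp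
  obtain ⟨r, hr⟩ : ∃ r, (j + 1 - s) / 2 = r := ⟨_, rfl⟩
  have hhead : ∀ A ∈ 𝒜, #(A ∩ range j) = r + s ∧ j + 1 = 2 * r + s ∧ 1 ≤ r ∧ r ≤ k := by
    intro A hA
    obtain ⟨hAc, hlast, rfl⟩ := h𝒜 A hA
    have hw := hlast.walk_eq
    have h1 : #(A ∩ range j) ≤ j := (card_le_card inter_subset_right).trans (card_range j).le
    have h2 := card_inter_add_card_sdiff A (range j)
    simp only [walk] at hw
    omega
  obtain ⟨-, hj, hr1, hrk⟩ := hhead A₀ hA₀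
  have hdecomp : ∀ A ∈ 𝒜, A ∩ range j ∪ T = A := fun A hA => by
    rw [← (h𝒜 A hA).2.2]
    grind
  have hc1 : #(𝒜.image (· ∩ range j)) = #𝒜 := card_image_of_injOn fun A hA B hB hAB => by
    rw [← hdecomp A hA, ← hdecomp B hB]
    exact congrArg (· ∪ T) hAB
  have hT : ∀ x ∈ T, x ∉ range j := fun x hx => by
    rw [← (h𝒜 A₀ hA₀).2.2] at hx
    exact (mem_sdiff.1 hx).2
  have hc2 : #(lowered s j T 𝒜) = #(kShadow r (𝒜.image (· ∩ range j))) := by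
    rw [lowered, hr]
    refine card_image_of_injOn fun K hK L hL hKL => ?_
    have hsub : ∀ K ∈ kShadow r (𝒜.image (· ∩ range j)), (K ∪ T) ∩ range j = K := by
      intro K hK
      obtain ⟨H, hH, hKH, -⟩ := mem_kShadow.1 hK
      obtain ⟨A, -, rfl⟩ := mem_image.1 hH
      grind
    rw [← hsub K hK, ← hsub L hL]
    exact congrArg (· ∩ range j) hKL
  have hlym := card_mul_choose_le_card_kShadow_mul_choose (r := r) (s := s) (X := range j)
    (𝒜 := 𝒜.image (· ∩ range j)) (by
      intro H hH
      obtain ⟨A, hA, rfl⟩ := mem_image.1 hH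
      exact mem_powersetCard.2 ⟨inter_subset_right, (hhead A hA).1⟩)
  rw [hc1, ← hc2, card_range] at hlym
  obtain ⟨q, rfl⟩ : ∃ q, r = q + 1 := ⟨r - 1, by omega⟩
  rw [show j - (q + 1) = q + s by omega] at hlym
  have hch : (q + 1 + s).choose s * (q + 1) = (q + s).choose s * (q + 1 + s) := by
    have := Nat.add_one_mul_choose_eq (q + s) q
    rw [Nat.choose_symm_add, show q + s + 1 = q + 1 + s by omega, Nat.choose_symm_add] at this
    linarith
  have hpos : 0 < (q + s).choose s := Nat.choose_pos (by omega)
  have h1 : #𝒜 * (q + 1 + s) ≤ #(lowered s j T 𝒜) * (q + 1) := by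
    refine Nat.le_of_mul_le_mul_right ?_ hpos
    calc _ = #𝒜 * ((q + s).choose s * (q + 1 + s)) := by ring
      _ = #𝒜 * (q + 1 + s).choose s * (q + 1) := by rw [← hch]; ring
      _ ≤ _ := Nat.mul_le_mul_right _ hlym
      _ = _ := by ring
  have h2 : #𝒜 ≤ #(lowered s j T 𝒜) := by nlinarith
  obtain ⟨d, hd⟩ := Nat.exists_eq_add_of_le h2
  obtain ⟨e, rfl⟩ := Nat.exists_eq_add_of_le hrk
  rw [hd] at h1 ⊢
  nlinarith

/-- Katona's intersecting shadow theorem for shifted families. -/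
lemma IsShifted.mul_card_le_mul_card_kShadow (hsh : IsShifted 𝒜) (h𝒜 : ∀ A ∈ 𝒜, #A = k + s)
    (hint : ∀ A ∈ 𝒜, ∀ B ∈ 𝒜, s + 1 ≤ #(A ∩ B)) :
    (k + s) * #𝒜 ≤ k * #(kShadow k 𝒜) := by
  have hex : ∀ A : Finset ℕ, ∃ j, A ∈ 𝒜 → IsLastVisit A (s + 1) j := fun A => by
    by_cases hA : A ∈ 𝒜
    · obtain ⟨j, hj⟩ := hsh.exists_isLastVisit hint hA
      exact ⟨j, fun _ => hj⟩
    · exact ⟨0, fun h => absurd h hA⟩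
  choose J hJ using hex
  let key : Finset ℕ → ℕ × Finset ℕ := fun A => (J A, A \ range (J A))
  have hfib : ∀ p, ∀ A ∈ {A ∈ 𝒜 | key A = p},
      #A = k + s ∧ IsLastVisit A (s + 1) p.1 ∧ A \ range p.1 = p.2 := by
    intro p A hA
    obtain ⟨hA', rfl⟩ := mem_filter.1 hA
    exact ⟨h𝒜 A hA', hJ A hA', rfl⟩
  have hdisj : ((𝒜.image key : Finset _) : Set (ℕ × Finset ℕ)).PairwiseDisjoint
      fun p => lowered s p.1 p.2 {A ∈ 𝒜 | key A = p} := by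
    intro p _ q _ hpq
    refine disjoint_left.2 fun K hK hK' => hpq ?_
    obtain ⟨-, h1, h2⟩ := exists_of_mem_lowered (hfib p) hK
    obtain ⟨-, h3, h4⟩ := exists_of_mem_lowered (hfib q) hK'
    have h5 := h1.unique h3
    exact Prod.ext h5 (by rw [← h2, ← h4, h5])
  have hsub : (𝒜.image key).biUnion (fun p => lowered s p.1 p.2 {A ∈ 𝒜 | key A = p}) ⊆
      kShadow k 𝒜 := biUnion_subset.2 fun p _ K hK =>
    kShadow_mono (filter_subset _ _) (exists_of_mem_lowered (hfib p) hK).1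
  calc (k + s) * #𝒜 = ∑ p ∈ 𝒜.image key, (k + s) * #{A ∈ 𝒜 | key A = p} := by
        rw [← mul_sum, ← card_eq_sum_card_image]
    _ ≤ ∑ p ∈ 𝒜.image key, k * #(lowered s p.1 p.2 {A ∈ 𝒜 | key A = p}) :=
        sum_le_sum fun p _ => mul_card_le_mul_card_lowered (hfib p)
    _ = k * #((𝒜.image key).biUnion fun p => lowered s p.1 p.2 {A ∈ 𝒜 | key A = p}) := by
        rw [← mul_sum, card_biUnion hdisj]
    _ ≤ k * #(kShadow k 𝒜) := Nat.mul_le_mul_left _ (card_le_card hsub)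

lemma mul_card_le_mul_card_kShadow (h𝒜 : ∀ A ∈ 𝒜, #A = k + s)
    (hint : ∀ A ∈ 𝒜, ∀ B ∈ 𝒜, s + 1 ≤ #(A ∩ B)) :
    (k + s) * #𝒜 ≤ k * #(kShadow k 𝒜) := by
  obtain ⟨ℬ, h1, h2, h3, h4, h5⟩ := exists_isShifted 𝒜 h𝒜 hint
  have := h1.mul_card_le_mul_card_kShadow h2 h3
  rw [h4] at this
  exact this.trans (Nat.mul_le_mul_left _ h5)

end KatonaShadow

section MainShadow

variable {k r s x y : ℕ}

lemma choose_add_le_choose (hx : x ≤ 2 * r + s) :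
    x.choose (r + s) ≤ x.choose r ∧
      (1 ≤ s → x < 2 * r + s → r + s ≤ x → x.choose (r + s) < x.choose r) := by
  have h := card_le_card_kShadow (r := r) (s := s) (X := range x) (subset_refl _)
    (by rwa [card_range])
  have hsub : kShadow r (powersetCard (r + s) (range x)) ⊆ powersetCard r (range x) := by
    intro K hK
    obtain ⟨A, hA, hKA, hK⟩ := mem_kShadow.1 hK
    exact mem_powersetCard.2 ⟨hKA.trans (mem_powersetCard.1 hA).1, hK⟩
  have hle := card_le_card hsub
  simp only [card_powersetCard, card_range] at h hle
  refine ⟨h.1.trans hle, fun hs hlt hrx => (h.2 hs hlt ?_).trans_le hle⟩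
  exact powersetCard_nonempty.2 (by rwa [card_range])

lemma choose_add_choose_le_of_le (hxy : x ≤ y) (hy : y ≤ 2 * r + s + 1) :
    x.choose (r + 1) + y.choose (r + 1 + s) ≤ y.choose (r + 1) + x.choose (r + 1 + s) ∧
      (1 ≤ s → r + s ≤ x → x < y → x < 2 * r + s →
        x.choose (r + 1) + y.choose (r + 1 + s) < y.choose (r + 1) + x.choose (r + 1 + s)) := by
  induction y, hxy using Nat.le_induction with
  | base => omega
  | succ y hxy ih =>
    obtain ⟨ih1, ih2⟩ := ih (by omega)
    have h1 : (y + 1).choose (r + 1) = y.choose r + y.choose (r + 1) := Nat.choose_succ_succ _ _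
    have h2 : (y + 1).choose (r + 1 + s) = y.choose (r + s) + y.choose (r + 1 + s) := by
      rw [show r + 1 + s = r + s + 1 by omega]
      exact Nat.choose_succ_succ _ _
    obtain ⟨h3, h4⟩ := choose_add_le_choose (r := r) (s := s) (x := y) (by omega)
    rw [h1, h2]
    refine ⟨by omega, fun hs hrx hlt hx => ?_⟩
    obtain rfl | hxy := hxy.eq_or_lt
    · have := h4 hs hx hrx
      omega
    · have := ih2 hs hrx hxy hx
      omega

lemma tripleShadow_add_card_lt_of_lt_card {𝒜 : Finset (Finset ℕ)} (hk : 4 ≤ k) (hs : 1 ≤ s)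
    (h𝒜 : ∀ A ∈ 𝒜, #A = k + s) (hint : ∀ A ∈ 𝒜, ∀ B ∈ 𝒜, s + 1 ≤ #(A ∩ B))
    (hlt : k + s + 1 < #𝒜) :
    tripleShadow k s + #𝒜 < #(kShadow k 𝒜) + 3 := by
  obtain ⟨q, rfl⟩ : ∃ q, k = q + 1 := ⟨k - 1, by omega⟩
  have htriple := (tripleShadow_add_le_choose hk hs).1
  rw [← Nat.choose_symm_of_eq_add (show q + 1 + s + 1 = q + 1 + (s + 1) by omega)] at htriple
  have hm : (q + 1 + s + 1).choose (q + 1 + s) = q + 1 + s + 1 := Nat.choose_succ_self_right _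
  have hmono : ∀ x, q + 1 + s + 1 < x → x ≤ 2 * q + s + 1 →
      tripleShadow (q + 1) s + x.choose (q + 1 + s) < x.choose (q + 1) + 3 := by
    intro x hx hx'
    have := (choose_add_choose_le_of_le (r := q) hx.le hx').2 hs (by omega) hx (by omega)
    omega
  obtain h | h := Nat.lt_or_ge #𝒜 ((2 * q + s + 1).choose (q + 1 + s))
  · have hex : ∃ x, q + 1 + s + 1 ≤ x ∧ #𝒜 < (x + 1).choose (q + 1 + s) :=
      ⟨2 * q + s, by omega, h⟩
    classical
    obtain ⟨hx1, hx2⟩ := Nat.find_spec hex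
    have hmin := fun y => Nat.find_min (H := hex) (m := y)
    set x := Nat.find hex
    have hxle : x ≤ 2 * q + s := Nat.find_min' hex ⟨by omega, h⟩
    have hx3 : x.choose (q + 1 + s) ≤ #𝒜 := by
      obtain hx | hx := hx1.eq_or_lt
      · rw [← hx, hm]
        exact hlt.le
      · by_contra! hc
        refine hmin (x - 1) (by omega) ⟨by omega, ?_⟩
        rwa [Nat.sub_add_cancel (by omega)]
    obtain ⟨h1, h2⟩ := card_add_choose_le_card_kShadow h𝒜 (by omega) hxle hx3 hx2.le
    obtain hx | hx := hx1.eq_or_lt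
    · rw [← hx] at h2
      have := h2 hs (by omega) (by omega)
      omega
    · have := hmono x hx (by omega)
      omega
  · have h1 := hmono (2 * q + s + 1) (by omega) le_rfl
    have h2 := mul_card_le_mul_card_kShadow h𝒜 hint
    have h3 : (2 * q + s + 1).choose (q + 1) * (q + 1) =
        (2 * q + s + 1).choose (q + 1 + s) * (q + 1 + s) := by
      rw [Nat.choose_succ_right_eq,
        ← Nat.choose_symm_of_eq_add (show 2 * q + s + 1 = q + (q + 1 + s) by omega),
        show 2 * q + s + 1 - q = q + 1 + s by omega]
    obtain ⟨d, hd⟩ := Nat.exists_eq_add_of_le h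
    rw [hd] at h2 ⊢
    nlinarith

/-- The shadow inequality behind the bound: among families of at least three `(k + s)`-sets with
pairwise intersections of size more than `s`, the excess `#(kShadow k 𝒜) - #𝒜` is smallest for
three subsets of a `(k + s + 1)`-set. -/
lemma tripleShadow_add_card_le {𝒜 : Finset (Finset ℕ)} (hk : 4 ≤ k) (hs : 1 ≤ s)
    (h𝒜 : ∀ A ∈ 𝒜, #A = k + s) (hint : ∀ A ∈ 𝒜, ∀ B ∈ 𝒜, s + 1 ≤ #(A ∩ B)) (h3 : 3 ≤ #𝒜) :
    tripleShadow k s + #𝒜 ≤ #(kShadow k 𝒜) + 3 ∧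
      (tripleShadow k s + #𝒜 = #(kShadow k 𝒜) + 3 → #𝒜 = 3 ∨ k = 4 ∧ #𝒜 = k + s + 1) := by
  obtain h | h := Nat.lt_or_ge (k + s + 1) #𝒜
  · have := tripleShadow_add_card_lt_of_lt_card hk hs h𝒜 hint h
    omega
  · exact tripleShadow_add_card_le_of_card_le hk hs h𝒜 h3 h

end MainShadow

section CrossFamily

variable {α : Type*} [DecidableEq α] {k s t : ℕ} {V U X Z : Finset α} {F : Finset (Finset α)}

/-- The `k`-subsets of `V` that meet every member of `F`. -/
def crossFamily (k : ℕ) (V : Finset α) (F : Finset (Finset α)) : Finset (Finset α) :=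
  {B ∈ powersetCard k V | ∀ A ∈ F, (A ∩ B).Nonempty}

lemma card_crossFamily_add_card_kShadow (k : ℕ) (V : Finset α) (F : Finset (Finset α)) :
    #(crossFamily k V F) + #(kShadow k (F.image (V \ ·))) = (#V).choose k := by
  have e : kShadow k (F.image (V \ ·)) =
      {B ∈ powersetCard k V | ¬ ∀ A ∈ F, (A ∩ B).Nonempty} := by
    ext B
    simp only [mem_kShadow, exists_mem_image, mem_filter, mem_powersetCard, not_forall,
      not_nonempty_iff_eq_empty, exists_prop, ← disjoint_iff_inter_eq_empty, subset_sdiff]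
    constructor
    · rintro ⟨A, hA, ⟨hBV, hBA⟩, hB⟩
      exact ⟨⟨hBV, hB⟩, A, hA, hBA.symm⟩
    · rintro ⟨⟨hBV, hB⟩, A, hA, hBA⟩
      exact ⟨A, hA, ⟨hBV, hBA.symm⟩, hB⟩
  rw [e, crossFamily, card_filter_add_card_filter_not, card_powersetCard]

lemma image_crossFamily (σ : Equiv.Perm α) (hV : V.image σ = V) :
    (crossFamily k V F).image (image σ) = crossFamily k V (F.image (image σ)) := by
  have hmem : ∀ B, B.image σ ∈ crossFamily k V (F.image (image σ)) ↔ B ∈ crossFamily k V F := by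
    intro B
    simp only [crossFamily, mem_filter, mem_powersetCard, forall_mem_image,
      ← image_inter _ _ σ.injective, image_nonempty, card_image_of_injective _ σ.injective]
    rw [← hV, image_subset_image_iff σ.injective, hV]
  ext B
  rw [mem_image]
  constructor
  · rintro ⟨C, hC, rfl⟩
    exact (hmem C).2 hC
  · intro hB
    have e : (B.image σ.symm).image σ = B := by
      rw [image_image, Equiv.self_comp_symm, image_id]
    exact ⟨B.image σ.symm, (hmem _).1 (by rwa [e]), e⟩

lemma card_image_insert (h : Disjoint X Z) : #(X.image (insert · Z)) = #X := by
  refine card_image_of_injOn fun x hx y hy hxy => ?_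
  have hxZ := disjoint_left.1 h hx
  have : x ∈ insert y Z := hxy ▸ mem_insert_self x Z
  exact (mem_insert.1 this).resolve_right hxZ

/-- The shadow of the family of all sets `U \ {x}` with `x ∈ X`. -/
lemma card_kShadow_image_erase_add (k : ℕ) (U X : Finset α) :
    #(kShadow k (X.image U.erase)) + #{K ∈ powersetCard k U | X ⊆ K} = (#U).choose k := by
  have e : kShadow k (X.image U.erase) = {K ∈ powersetCard k U | ¬ X ⊆ K} := by
    ext K
    simp only [mem_kShadow, exists_mem_image, mem_filter, mem_powersetCard, subset_erase,
      not_subset]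
    constructor
    · rintro ⟨x, hx, ⟨hKU, hxK⟩, hK⟩
      exact ⟨⟨hKU, hK⟩, x, hx, hxK⟩
    · rintro ⟨⟨hKU, hK⟩, x, hx, hxK⟩
      exact ⟨x, hx, ⟨hKU, hxK⟩, hK⟩
  rw [e, add_comm, card_filter_add_card_filter_not, card_powersetCard]

lemma card_kShadow_image_erase (hk : 4 ≤ k) (hX : X ⊆ U) (hU : #U = k + s + 1)
    (hc : #X = 3 ∨ k = 4 ∧ #X = k + s + 1) :
    tripleShadow k s + #X = #(kShadow k (X.image U.erase)) + 3 := by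
  have h := card_kShadow_image_erase_add k U X
  have h' := choose_eq_tripleShadow_add (k := k) (s := s) (by omega)
  rw [hU, Nat.choose_symm_of_eq_add (show k + s + 1 = k + (s + 1) by omega), h'] at h
  obtain hc | ⟨rfl, hc⟩ := hc
  · rw [card_filter_superset_powersetCard hX (by omega), hU, hc,
      Nat.choose_symm_of_eq_add (show k + s + 1 - 3 = k - 3 + (s + 1) by omega),
      show k + s + 1 - 3 = k + s - 2 by omega] at h
    omega
  · have e : {K ∈ powersetCard 4 U | X ⊆ K} = ∅ := by
      refine filter_eq_empty_iff.2 fun K hK hXK => ?_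
      have := card_le_card hXK
      have := (mem_powersetCard.1 hK).2
      omega
    rw [e, card_empty, show 4 + s - 2 = s + 1 + 1 by omega, Nat.choose_succ_self_right] at h
    omega

lemma card_add_card_crossFamily_add (hk : 4 ≤ k) (hX : X ⊆ V \ Z)
    (hU : #(V \ Z) = k + s + 1) (hc : #X = 3 ∨ k = 4 ∧ #X = k + s + 1) :
    #(X.image (insert · Z)) + #(crossFamily k V (X.image (insert · Z))) + tripleShadow k s =
      (#V).choose k + 3 := by
  have h1 := card_crossFamily_add_card_kShadow k V (X.image (insert · Z))
  have h2 := card_kShadow_image_erase hk hX hU hc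
  have e : (X.image (insert · Z)).image (V \ ·) = X.image (V \ Z).erase := by
    rw [image_image]
    exact image_congr fun x _ => by
      simp only [Function.comp]
      rw [sdiff_insert]
  rw [e] at h1
  rw [card_image_insert (disjoint_sdiff_self_left.mono_left hX)]
  omega

/-- A family of `(k + t)`-subsets of `V` whose complements lie in a common `(k + s + 1)`-set
consists of one-point extensions of a fixed set. -/
lemma exists_eq_image_insert (hV : #V = 2 * k + t + s) (hk : 1 ≤ k)
    (hF : F ⊆ powersetCard (k + t) V) (hF2 : 1 < #F) (hU : #U = k + s + 1)
    (h : ∀ A ∈ F, V \ A ⊆ U) :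
    ∃ Z ⊆ V, #Z = k + t - 1 ∧ ∃ X ⊆ V \ Z, F = X.image (insert · Z) := by
  obtain ⟨A, hA, B, hB, hAB⟩ := one_lt_card.1 hF2
  have hA' := mem_powersetCard.1 (hF hA)
  have hB' := mem_powersetCard.1 (hF hB)
  have hUV : V ∩ U = U := by
    refine eq_of_subset_of_card_le inter_subset_right ?_
    by_contra! hlt
    have hA1 : V \ A = V ∩ U := eq_of_subset_of_card_le
      (subset_inter sdiff_subset (h A hA)) (by rw [card_sdiff_of_subset hA'.1]; omega)
    have hB1 : V \ B = V ∩ U := eq_of_subset_of_card_le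
      (subset_inter sdiff_subset (h B hB)) (by rw [card_sdiff_of_subset hB'.1]; omega)
    apply hAB
    rw [← Finset.sdiff_sdiff_eq_self hA'.1, ← Finset.sdiff_sdiff_eq_self hB'.1, hA1, hB1]
  rw [inter_eq_right] at hUV
  have hZ : #(V \ U) = k + t - 1 := by
    rw [card_sdiff_of_subset hUV]
    omega
  refine ⟨V \ U, sdiff_subset, hZ, {x ∈ U | insert x (V \ U) ∈ F}, ?_, ?_⟩
  · rw [Finset.sdiff_sdiff_eq_self hUV]
    exact filter_subset _ _
  · ext C
    simp only [mem_image, mem_filter]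
    constructor
    · intro hC
      have hC' := mem_powersetCard.1 (hF hC)
      obtain ⟨x, hx, rfl⟩ := exists_eq_insert_iff.2
        ⟨show V \ U ⊆ C from sdiff_le_comm.1 (h C hC), by omega⟩
      refine ⟨x, ⟨?_, hC⟩, rfl⟩
      by_contra hxU
      exact hx (mem_sdiff.2 ⟨hC'.1 (mem_insert_self _ _), hxU⟩)
    · rintro ⟨x, hx, rfl⟩
      exact hx.2

end CrossFamily

section Perm

variable {α : Type*} [DecidableEq α]

lemma exists_perm_image_eq {S T : Finset α} (h : #S = #T) :
    ∃ σ : Equiv.Perm α, S.image σ = T ∧ ∀ x, x ∉ S → x ∉ T → σ x = x := by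
  induction hd : #(S \ T) generalizing S with
  | zero =>
    rw [card_eq_zero, sdiff_eq_empty_iff_subset] at hd
    exact ⟨1, by simpa using eq_of_subset_of_card_le hd h.ge, by simp⟩
  | succ d ih =>
    have h' : #(T \ S) = d + 1 := by rw [← hd, card_sdiff_comm h]
    obtain ⟨a, ha⟩ := card_pos.1 (show 0 < #(S \ T) by omega)
    obtain ⟨b, hb⟩ := card_pos.1 (show 0 < #(T \ S) by omega)
    rw [mem_sdiff] at ha hb
    have himage : S.image (Equiv.swap a b) = insert b (S.erase a) := by
      conv_lhs => rw [← insert_erase ha.1, image_insert, Equiv.swap_apply_left]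
      congr 1
      refine (image_congr fun x hx => ?_).trans image_id
      rw [mem_coe, mem_erase] at hx
      exact Equiv.swap_apply_of_ne_of_ne hx.1 fun hxb => hb.2 (hxb ▸ hx.2)
    have hcard : #(insert b (S.erase a)) = #T := by
      rw [← himage, card_image_of_injective _ (Equiv.injective _), h]
    have hsdiff : insert b (S.erase a) \ T = (S \ T).erase a := by
      rw [insert_sdiff_of_mem _ hb.1, erase_sdiff_comm]
    obtain ⟨σ, h1, h2⟩ := ih hcard (by rw [hsdiff, card_erase_of_mem (mem_sdiff.2 ha), hd]; rfl)
    refine ⟨(Equiv.swap a b).trans σ, ?_, fun x hxS hxT => ?_⟩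
    · rw [Equiv.coe_trans, ← image_image, himage, h1]
    · have hxb : x ≠ b := fun hxb => hxT (hxb ▸ hb.1)
      have hxa : x ≠ a := fun hxa => hxS (hxa ▸ ha.1)
      rw [Equiv.trans_apply, Equiv.swap_apply_of_ne_of_ne hxa hxb]
      exact h2 x (by simp [hxb, hxS]) hxT

lemma image_eq_of_forall_apply_eq {V : Finset α} {σ : Equiv.Perm α} (h : ∀ x, x ∉ V → σ x = x) :
    V.image σ = V := by
  refine eq_of_subset_of_card_le (image_subset_iff.2 fun x hx => ?_)
    (card_image_of_injective _ σ.injective).ge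
  by_contra hσ
  exact hσ (by rwa [σ.injective (h _ hσ)])

/-- A permutation preserving `V` that moves a pair of disjoint subsets to another such pair. -/
lemma exists_perm_image_eq_image_eq {V Z X Z' X' : Finset α} (hZ : Z ⊆ V) (hX : X ⊆ V)
    (hZ' : Z' ⊆ V) (hX' : X' ⊆ V) (hd : Disjoint X Z) (hd' : Disjoint X' Z') (hcZ : #Z = #Z')
    (hcX : #X = #X') :
    ∃ σ : Equiv.Perm α, V.image σ = V ∧ Z.image σ = Z' ∧ X.image σ = X' := by
  obtain ⟨σ, h1, h2⟩ := exists_perm_image_eq hcZ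
  have hσV := image_eq_of_forall_apply_eq fun x hx => h2 x (fun h => hx (hZ h)) fun h => hx (hZ' h)
  have hσX : X.image σ ⊆ V := by
    rw [← hσV]
    exact image_subset_image hX
  have hσd : Disjoint (X.image σ) Z' := by
    rw [← h1]
    exact (disjoint_image σ.injective).2 hd
  obtain ⟨τ, h3, h4⟩ := exists_perm_image_eq
    (show #(X.image σ) = #X' by rw [card_image_of_injective _ σ.injective, hcX])
  have hτV := image_eq_of_forall_apply_eq fun x hx => h4 x (fun h => hx (hσX h)) fun h => hx (hX' h)
  refine ⟨σ.trans τ, ?_, ?_, ?_⟩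
  · rw [Equiv.coe_trans, ← image_image, hσV, hτV]
  · rw [Equiv.coe_trans, ← image_image, h1]
    refine (image_congr fun x hx => ?_).trans image_id
    exact h4 x (disjoint_right.1 hσd hx) (disjoint_right.1 hd' hx)
  · rw [Equiv.coe_trans, ← image_image, h3]

end Perm

section CrossIntersecting

variable {k s t n : ℕ} {V : Finset ℕ} {F G : Finset (Finset ℕ)}

lemma choose_add_choose_add_choose_eq_tripleShadow (hk : 2 ≤ k) (hn : n = 2 * k + t + s) :
    (n - k - t).choose k + (n - k - t - 1).choose (k - 1) + (n - k - t - 2).choose (k - 2) =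
      tripleShadow k s := by
  rw [tripleShadow, Nat.choose_symm_of_eq_add (show n - k - t = k + s by omega),
    Nat.choose_symm_of_eq_add (show n - k - t - 1 = k - 1 + s by omega),
    Nat.choose_symm_of_eq_add (show n - k - t - 2 = k - 2 + s by omega),
    show n - k - t = k + s by omega]

lemma card_add_card_add_tripleShadow_le (hk : 4 ≤ k) (hV : #V = 2 * k + t + s)
    (hF : F ⊆ powersetCard (k + t) V) (hG : G ⊆ crossFamily k V F)
    (hint : ∀ A ∈ F, ∀ B ∈ F, t + 1 ≤ #(A ∩ B)) (hF3 : 3 ≤ #F) :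
    #F + #G + tripleShadow k s ≤ (#V).choose k + 3 ∧
      (1 ≤ s → #F + #G + tripleShadow k s = (#V).choose k + 3 →
        G = crossFamily k V F ∧ (#F = 3 ∨ k = 4 ∧ #F = k + s + 1) ∧
        ∃ Z ⊆ V, #Z = k + t - 1 ∧ ∃ X ⊆ V \ Z, F = X.image (insert · Z)) := by
  have hFV := fun A (hA : A ∈ F) => mem_powersetCard.1 (hF hA)
  have hcross := card_crossFamily_add_card_kShadow k V F
  have hle := card_le_card hG
  have hcard : #(F.image (V \ ·)) = #F := card_image_of_injOn fun A hA B hB hAB => by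
    rw [← Finset.sdiff_sdiff_eq_self (hFV A hA).1, ← Finset.sdiff_sdiff_eq_self (hFV B hB).1]
    exact congrArg (V \ ·) hAB
  have hsized : ∀ A ∈ F.image (V \ ·), #A = k + s := by
    refine forall_mem_image.2 fun A hA => ?_
    obtain ⟨h1, h2⟩ := hFV A hA
    rw [card_sdiff_of_subset h1]
    omega
  have hint' : ∀ A ∈ F.image (V \ ·), ∀ B ∈ F.image (V \ ·), s + 1 ≤ #(A ∩ B) := by
    refine forall_mem_image.2 fun A hA => forall_mem_image.2 fun B hB => ?_
    obtain ⟨hA1, hA2⟩ := hFV A hA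
    obtain ⟨hB1, hB2⟩ := hFV B hB
    rw [← sdiff_union_distrib, card_sdiff_of_subset (union_subset hA1 hB1)]
    have := card_union_add_card_inter A B
    have := hint A hA B hB
    omega
  obtain rfl | hs := Nat.eq_zero_or_pos s
  · have hsub : F.image (V \ ·) ⊆ kShadow k (F.image (V \ ·)) := fun A hA =>
      mem_kShadow.2 ⟨A, hA, Subset.rfl, hsized A hA⟩
    have := card_le_card hsub
    have h0 : tripleShadow k 0 = 3 := by simp [tripleShadow]
    omega
  · obtain ⟨h1, h2⟩ := tripleShadow_add_card_le hk hs hsized hint' (by omega)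
    rw [hcard] at h1 h2
    refine ⟨by omega, fun _ heq => ?_⟩
    have hcase := h2 (by omega)
    obtain ⟨U, hU, hsub⟩ := exists_card_eq_forall_subset hk hs hsized (by rwa [hcard])
      (by rw [hcard]; omega)
    exact ⟨eq_of_subset_of_card_le hG (by omega), hcase, exists_eq_image_insert hV (by omega) hF
      (by omega) hU (forall_mem_image.1 hsub)⟩

end CrossIntersecting

/-- Main result: let `k ≥ 4`, `t ≥ 0`, `n ≥ 2k+t`, and let `ℱ ⊆ ([n] choose k+t)`,
`𝒢 ⊆ ([n] choose k)` be cross-intersecting with `ℱ` `(t+1)`-intersecting and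
`|ℱ| ≥ 3`.  Then `|ℱ|+|𝒢| ≤ C(n,k) − C(n−k−t,k) − C(n−k−t−1,k−1) − C(n−k−t−2,k−2) + 3`,
and for `n > 2k+t` equality holds iff, up to a permutation of `[n]`, the pair
`(ℱ,𝒢)` is one of the two extremal configurations. -/
theorem stmt_0 (k t n : ℕ) (hk : 4 ≤ k) (hn : 2 * k + t ≤ n)
    (F G : Finset (Finset ℕ))
    (hF : F ⊆ powersetCard (k + t) (Icc 1 n))
    (hG : G ⊆ powersetCard k (Icc 1 n))
    (hcross : ∀ A ∈ F, ∀ B ∈ G, (A ∩ B).Nonempty)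
    (hint : ∀ A ∈ F, ∀ B ∈ F, t + 1 ≤ (A ∩ B).card)
    (hF3 : 3 ≤ F.card) :
    ((F.card : ℤ) + G.card ≤
      (n.choose k : ℤ) - (n - k - t).choose k - (n - k - t - 1).choose (k - 1)
        - (n - k - t - 2).choose (k - 2) + 3) ∧
    (2 * k + t < n →
      (((F.card : ℤ) + G.card =
        (n.choose k : ℤ) - (n - k - t).choose k - (n - k - t - 1).choose (k - 1)
          - (n - k - t - 2).choose (k - 2) + 3) ↔
      ∃ σ : Equiv.Perm ℕ, (∀ x ∈ Icc 1 n, σ x ∈ Icc 1 n) ∧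
        ((F.image (fun s => s.image fun x => σ x) =
            {insert (k + t) (Icc 1 (k + t - 1)), insert (k + t + 1) (Icc 1 (k + t - 1)),
              insert (k + t + 2) (Icc 1 (k + t - 1))} ∧
          G.image (fun s => s.image fun x => σ x) =
            (powersetCard k (Icc 1 n)).filter fun B =>
              ∀ i ∈ Icc 1 3, (B ∩ insert (k + t - 1 + i) (Icc 1 (k + t - 1))).Nonempty) ∨
         (k = 4 ∧
          F.image (fun s => s.image fun x => σ x) =
            (Icc (t + 4) n).image (fun i => insert i (Icc 1 (t + 3))) ∧
          G.image (fun s => s.image fun x => σ x) =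
            (powersetCard k (Icc 1 n)).filter fun B => (B ∩ Icc 1 (t + 3)).Nonempty)))) := by
  obtain ⟨s, rfl⟩ := Nat.exists_eq_add_of_le hn
  set n := 2 * k + t + s with hn_def
  have hV : #(Icc 1 n) = n := by simp
  have htriple := choose_add_choose_add_choose_eq_tripleShadow (show 2 ≤ k by omega) hn_def
  have hGsub : G ⊆ crossFamily k (Icc 1 n) F := fun B hB =>
    mem_filter.2 ⟨hG hB, fun A hA => hcross A hA B hB⟩
  obtain ⟨hle, hstruct⟩ := card_add_card_add_tripleShadow_le hk hV hF hGsub hint hF3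
  rw [hV] at hle hstruct
  refine ⟨by omega, fun hlt => ?_⟩
  have hs : 1 ≤ s := by omega
  have hiff : ((F.card : ℤ) + G.card =
      (n.choose k : ℤ) - (n - k - t).choose k - (n - k - t - 1).choose (k - 1)
        - (n - k - t - 2).choose (k - 2) + 3) ↔
      #F + #G + tripleShadow k s = n.choose k + 3 := by omega
  have hsdiff : Icc 1 n \ Icc 1 (k + t - 1) = Icc (k + t) n := by
    ext x
    simp only [mem_sdiff, mem_Icc]
    omega
  have htripleIcc : (Icc (k + t) (k + t + 2)).image (insert · (Icc 1 (k + t - 1))) =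
      {insert (k + t) (Icc 1 (k + t - 1)), insert (k + t + 1) (Icc 1 (k + t - 1)),
        insert (k + t + 2) (Icc 1 (k + t - 1))} := by
    have e : Icc (k + t) (k + t + 2) = {k + t, k + t + 1, k + t + 2} := by
      ext x
      simp only [mem_Icc, mem_insert, mem_singleton]
      omega
    rw [e, image_insert, image_insert, image_singleton]
  have hcross3 : crossFamily k (Icc 1 n)
      ((Icc (k + t) (k + t + 2)).image (insert · (Icc 1 (k + t - 1)))) =
      (powersetCard k (Icc 1 n)).filter fun B =>
        ∀ i ∈ Icc 1 3, (B ∩ insert (k + t - 1 + i) (Icc 1 (k + t - 1))).Nonempty := by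
    refine filter_congr fun B _ => ?_
    simp only [forall_mem_image, inter_comm B]
    constructor
    · intro h i hi
      rw [mem_Icc] at hi
      exact h (mem_Icc.2 (by omega))
    · intro h i hi
      rw [mem_Icc] at hi
      have := h (i - (k + t - 1)) (mem_Icc.2 (by omega))
      rwa [show k + t - 1 + (i - (k + t - 1)) = i by omega] at this
  have hcross4 : k = 4 → crossFamily k (Icc 1 n)
      ((Icc (k + t) n).image (insert · (Icc 1 (k + t - 1)))) =
      (powersetCard k (Icc 1 n)).filter fun B => (B ∩ Icc 1 (k + t - 1)).Nonempty := by
    intro hk4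
    refine filter_congr fun B hB => ?_
    simp only [forall_mem_image, inter_comm B]
    constructor
    · intro h
      by_contra hne
      have hsub : Icc (k + t) n ⊆ B := by
        intro i hi
        obtain ⟨x, hx⟩ := h hi
        rw [mem_inter, mem_insert] at hx
        obtain ⟨rfl | hxZ, hxB⟩ := hx
        · exact hxB
        · exact absurd ⟨x, mem_inter.2 ⟨hxZ, hxB⟩⟩ hne
      have := card_le_card hsub
      rw [(mem_powersetCard.1 hB).2, Nat.card_Icc] at this
      omega
    · intro h i _
      exact h.mono (inter_subset_inter_right (subset_insert _ _))
  rw [hiff]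
  constructor
  · intro heq
    obtain ⟨hGeq, hcase, Z, hZ, hZc, X, hX, hFX⟩ := hstruct hs heq
    have hXZ : Disjoint X Z := disjoint_sdiff_self_left.mono_left hX
    have hXc : #X = #F := by rw [hFX, card_image_insert hXZ]
    obtain ⟨σ, hσV, hσZ, hσX⟩ := exists_perm_image_eq_image_eq (V := Icc 1 n)
      (Z' := Icc 1 (k + t - 1)) (X' := Icc (k + t) (k + t + #X - 1)) hZ
      (hX.trans sdiff_subset) (Icc_subset_Icc_right (by omega))
      (Icc_subset_Icc (by omega) (by omega)) hXZ
      (disjoint_left.2 fun x hx hx' => by rw [mem_Icc] at hx hx'; omega)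
      (by rw [hZc, Nat.card_Icc]; omega) (by rw [Nat.card_Icc]; omega)
    have hσF : F.image (image σ) =
        (Icc (k + t) (k + t + #X - 1)).image (insert · (Icc 1 (k + t - 1))) := by
      rw [hFX, ← hσX, image_image, image_image]
      exact image_congr fun x _ => by
        simp only [Function.comp]
        rw [image_insert, hσZ]
    have hσG : G.image (image σ) = crossFamily k (Icc 1 n) (F.image (image σ)) := by
      rw [hGeq, image_crossFamily σ hσV]
    refine ⟨σ, fun x hx => ?_, ?_⟩
    · rw [← hσV]
      exact mem_image_of_mem _ hx
    change (F.image (image σ) = _ ∧ G.image (image σ) = _) ∨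
      (k = 4 ∧ F.image (image σ) = _ ∧ G.image (image σ) = _)
    rw [hσG, hσF]
    obtain hc | ⟨hk4, hc⟩ := hcase
    · rw [show k + t + #X - 1 = k + t + 2 by omega]
      exact Or.inl ⟨htripleIcc, hcross3⟩
    · rw [show k + t + #X - 1 = n by omega, show t + 4 = k + t by omega,
        show t + 3 = k + t - 1 by omega]
      exact Or.inr ⟨hk4, rfl, hcross4 hk4⟩
  · rintro ⟨σ, -, h⟩
    change (F.image (image σ) = _ ∧ G.image (image σ) = _) ∨
      (k = 4 ∧ F.image (image σ) = _ ∧ G.image (image σ) = _) at h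
    have hinj : ∀ H : Finset (Finset ℕ), #(H.image (image σ)) = #H := fun H =>
      card_image_of_injective _ (image_injective σ.injective)
    rw [← hinj F, ← hinj G]
    have hcount : ∀ X ⊆ Icc (k + t) n, #X = 3 ∨ k = 4 ∧ #X = k + s + 1 →
        #(X.image (insert · (Icc 1 (k + t - 1)))) + #(crossFamily k (Icc 1 n)
          (X.image (insert · (Icc 1 (k + t - 1))))) + tripleShadow k s = n.choose k + 3 := by
      intro X hX hc
      rw [← hsdiff] at hX
      have := card_add_card_crossFamily_add hk hX
        (by rw [hsdiff, Nat.card_Icc]; omega) hc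
      rwa [hV] at this
    obtain ⟨h1, h2⟩ | ⟨hk4, h1, h2⟩ := h
    · rw [h1, h2, ← htripleIcc, ← hcross3]
      exact hcount _ (Icc_subset_Icc_right (by omega)) (Or.inl (by rw [Nat.card_Icc]; omega))
    · rw [show t + 4 = k + t by omega, show t + 3 = k + t - 1 by omega] at h1
      rw [show t + 3 = k + t - 1 by omega, ← hcross4 hk4] at h2
      rw [h1, h2]
      exact hcount _ Subset.rfl (Or.inr ⟨hk4, by rw [Nat.card_Icc]; omega⟩)
end

section
/- Let k ≥ 1, t ≥ 0 and n ≥ 2k+t be integers. Let ℱ ⊆ ([n] choose k+t) and 𝒢 ⊆ ([n] choose k) be cross-intersecting families. If ℱ is (t+1)-intersecting and |ℱ| ≥ 1, then |ℱ| + |𝒢| ≤ C(n,k) − C(n−k−t,k) + 1. -/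
open Finset
open scoped FinsetFamily

section Compression

variable {α : Type*} [DecidableEq α]

lemma card_inter_eq_add_ite {i j : α} (hij : i ≠ j) (A B : Finset α) :
    #(A ∩ B) = #((A ∩ B) \ {i, j}) + (if i ∈ A ∧ i ∈ B then 1 else 0)
      + (if j ∈ A ∧ j ∈ B then 1 else 0) := by
  have h := card_sdiff_add_card_inter (A ∩ B) {i, j}
  have h2 : #((A ∩ B) ∩ {i, j}) = (if i ∈ A ∧ i ∈ B then 1 else 0)
      + (if j ∈ A ∧ j ∈ B then 1 else 0) := by
    rw [inter_comm, ← filter_mem_eq_inter, card_filter, sum_pair hij]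
    simp only [mem_inter]
  omega

lemma mem_singleton_compression_cases {i j : α} {F : Finset (Finset α)} {A : Finset α}
    (hA : A ∈ 𝓒 {i} {j} F) :
    (A ∈ F ∧ (i ∉ A → j ∈ A → insert i (A.erase j) ∈ F)) ∨
      (i ∈ A ∧ j ∉ A ∧ insert j (A.erase i) ∈ F) := by
  by_cases h : A ∈ F
  · refine Or.inl ⟨h, fun hi hj => ?_⟩
    rw [UV.mem_compression] at hA
    rcases hA with hA | hA
    · have h2 := hA.2
      rw [UV.compress_of_disjoint_of_le (by simpa using hi) (by simpa using hj)] at h2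
      convert h2 using 1
      ext x
      simp only [sup_eq_union, mem_insert, mem_erase, mem_sdiff, mem_union, mem_singleton]
      grind
    · exact absurd h hA.1
  · have h1 := UV.sup_sdiff_mem_of_mem_compression_of_notMem hA h
    have h2 := UV.le_of_mem_compression_of_notMem hA h
    have h3 := UV.disjoint_of_mem_compression_of_notMem hA h
    have hi : i ∈ A := by simpa using h2
    have hj : j ∉ A := by simpa using h3
    refine Or.inr ⟨hi, hj, ?_⟩
    convert h1 using 1
    ext x
    simp only [sup_eq_union, mem_insert, mem_erase, mem_sdiff, mem_union, mem_singleton]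
    grind

lemma le_card_inter_of_mem_compression_s1 {i j : α} (hij : i ≠ j) {s : ℕ}
    {F G : Finset (Finset α)} (h : ∀ A ∈ F, ∀ B ∈ G, s ≤ #(A ∩ B)) :
    ∀ A ∈ 𝓒 {i} {j} F, ∀ B ∈ 𝓒 {i} {j} G, s ≤ #(A ∩ B) := by
  intro A hA B hB
  have key : ∀ A' ∈ F, ∀ B' ∈ G, A' \ {i, j} = A \ {i, j} → B' \ {i, j} = B \ {i, j} →
      (if i ∈ A' ∧ i ∈ B' then 1 else 0) + (if j ∈ A' ∧ j ∈ B' then 1 else 0) ≤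
      (if i ∈ A ∧ i ∈ B then 1 else 0) + (if j ∈ A ∧ j ∈ B then 1 else 0) → s ≤ #(A ∩ B) := by
    intro A' hA' B' hB' hAA hBB hle
    have h1 := h A' hA' B' hB'
    rw [card_inter_eq_add_ite hij] at h1 ⊢
    have : (A' ∩ B') \ {i, j} = (A ∩ B) \ {i, j} := by
      ext x
      have hx := Finset.ext_iff.1 hAA x
      have hy := Finset.ext_iff.1 hBB x
      simp only [mem_sdiff, mem_inter] at hx hy ⊢
      tauto
    rw [this] at h1
    omega
  have hout : ∀ (C : Finset α) (x y : α), x = i ∧ y = j ∨ x = j ∧ y = i →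
      insert x (C.erase y) \ {i, j} = C \ {i, j} := by
    intro C x y hxy
    ext z
    simp only [mem_sdiff, mem_insert, mem_erase, mem_singleton]
    grind
  rcases mem_singleton_compression_cases hA with ⟨hA1, hA2⟩ | ⟨hiA, hjA, hA1⟩ <;>
    rcases mem_singleton_compression_cases hB with ⟨hB1, hB2⟩ | ⟨hiB, hjB, hB1⟩
  · exact h A hA1 B hB1
  · by_cases hc : i ∉ A ∧ j ∈ A
    · refine key _ (hA2 hc.1 hc.2) _ hB1 (hout A i j (by simp)) (hout B j i (by simp)) ?_
      simp [hc, hij, hij.symm]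
    · refine key _ hA1 _ hB1 rfl (hout B j i (by simp)) ?_
      grind
  · by_cases hc : i ∉ B ∧ j ∈ B
    · refine key _ hA1 _ (hB2 hc.1 hc.2) (hout A j i (by simp)) (hout B i j (by simp)) ?_
      simp [hc, hij, hij.symm]
    · refine key _ hA1 _ hB1 (hout A j i (by simp)) rfl ?_
      grind
  · refine key _ hA1 _ hB1 (hout A j i (by simp)) (hout B j i (by simp)) ?_
    simp [hiA, hjA, hiB, hjB, hij, hij.symm]

lemma compression_subset_powersetCard {i j : α} {V : Finset α} (hi : i ∈ V)
    {r : ℕ} {F : Finset (Finset α)} (hF : F ⊆ powersetCard r V) :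
    𝓒 {i} {j} F ⊆ powersetCard r V := by
  intro A hA
  rw [UV.mem_compression] at hA
  rcases hA with hA | ⟨-, B, hB, rfl⟩
  · exact hF hA.1
  · have hB' := mem_powersetCard.1 (hF hB)
    refine mem_powersetCard.2 ⟨?_, (UV.card_compress (by simp) B).trans hB'.2⟩
    unfold UV.compress
    split_ifs
    · exact sdiff_subset.trans (union_subset hB'.1 (singleton_subset_iff.2 hi))
    · exact hB'.1

lemma filter_mem_compression_subset (i j : α) (F : Finset (Finset α)) :
    {A ∈ 𝓒 {i} {j} F | j ∈ A} ⊆ {A ∈ F | j ∈ A} := by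
  intro A hA
  rw [mem_filter] at hA ⊢
  rcases mem_singleton_compression_cases hA.1 with h | h
  · exact ⟨h.1, hA.2⟩
  · exact absurd hA.2 h.2.1

lemma isCompressed_of_card_filter_le {i j : α} {F : Finset (Finset α)}
    (h : #{A ∈ F | j ∈ A} ≤ #{A ∈ 𝓒 {i} {j} F | j ∈ A}) : UV.IsCompressed {i} {j} F := by
  have heq := eq_of_subset_of_card_le (filter_mem_compression_subset i j F) h
  refine (eq_of_subset_of_card_le (fun A hA => ?_) (UV.card_compression _ _ _).le).symm
  by_cases hj : j ∈ A
  · have : A ∈ {A ∈ 𝓒 {i} {j} F | j ∈ A} := by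
      rw [heq]
      exact mem_filter.2 ⟨hA, hj⟩
    exact (mem_filter.1 this).1
  · have := UV.compress_mem_compression (u := {i}) (v := {j}) hA
    rwa [UV.compress, if_neg (by simp [hj])] at this

lemma UV.IsCompressed.insert_erase_mem {i j : α} {F : Finset (Finset α)}
    (h : UV.IsCompressed {i} {j} F) {A : Finset α} (hA : A ∈ F) (hi : i ∉ A) (hj : j ∈ A) :
    insert i (A.erase j) ∈ F := by
  rw [← h.eq] at hA
  rcases mem_singleton_compression_cases hA with h1 | h1
  · exact h1.2 hi hj
  · exact absurd h1.1 hi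

end Compression

section Frankl

variable {α : Type*} [DecidableEq α]

/-- `F` is a nonempty `(t + 1)`-intersecting family of `(k + t)`-subsets of `V`, and `G` is a
family of `k`-subsets of `V` such that `F` and `G` are cross-intersecting. -/
structure IsFranklPair (V : Finset α) (k t : ℕ) (F G : Finset (Finset α)) : Prop where
  left_subset : F ⊆ powersetCard (k + t) V
  right_subset : G ⊆ powersetCard k V
  cross : ∀ A ∈ F, ∀ B ∈ G, 1 ≤ #(A ∩ B)
  inter : ∀ A ∈ F, ∀ B ∈ F, t + 1 ≤ #(A ∩ B)
  nonempty : F.Nonempty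

namespace IsFranklPair

variable {V : Finset α} {k t : ℕ} {F G : Finset (Finset α)} {a : α}

lemma one_le (h : IsFranklPair V k t F G) : 1 ≤ k := by
  obtain ⟨A, hA⟩ := h.nonempty
  have h1 := h.inter A hA A hA
  rw [inter_self, (mem_powersetCard.1 (h.left_subset hA)).2] at h1
  omega

lemma compression (h : IsFranklPair V k t F G) {i j : α} (hi : i ∈ V) (hij : i ≠ j) :
    IsFranklPair V k t (𝓒 {i} {j} F) (𝓒 {i} {j} G) where
  left_subset := compression_subset_powersetCard hi h.left_subset
  right_subset := compression_subset_powersetCard hi h.right_subset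
  cross := le_card_inter_of_mem_compression_s1 hij h.cross
  inter := le_card_inter_of_mem_compression_s1 hij h.inter
  nonempty := by
    rw [← card_pos, UV.card_compression]
    exact h.nonempty.card_pos

/-- Compressing towards the elements of `V` other than `j`, one can make both families of a pair
stable under all these compressions. -/
lemma exists_isCompressed {j : α} (m : ℕ) : ∀ F G : Finset (Finset α),
    IsFranklPair V k t F G → #{A ∈ F | j ∈ A} + #{A ∈ G | j ∈ A} = m →
    ∃ F' G', IsFranklPair V k t F' G' ∧ #F' = #F ∧ #G' = #G ∧
      ∀ i ∈ V, i ≠ j → UV.IsCompressed {i} {j} F' ∧ UV.IsCompressed {i} {j} G' := by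
  induction m using Nat.strong_induction_on with
  | _ m ih =>
    intro F G h hm
    by_cases hst : ∀ i ∈ V, i ≠ j → UV.IsCompressed {i} {j} F ∧ UV.IsCompressed {i} {j} G
    · exact ⟨F, G, h, rfl, rfl, hst⟩
    · push Not at hst
      obtain ⟨i, hi, hij, hne⟩ := hst
      have h1 := card_le_card (filter_mem_compression_subset i j F)
      have h2 := card_le_card (filter_mem_compression_subset i j G)
      have hlt : #{A ∈ 𝓒 {i} {j} F | j ∈ A} + #{A ∈ 𝓒 {i} {j} G | j ∈ A} < m := by
        by_contra hge
        exact hne (isCompressed_of_card_filter_le (by omega))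
          (isCompressed_of_card_filter_le (by omega))
      obtain ⟨F', G', h', hF', hG', hst'⟩ := ih _ hlt _ _ (h.compression hi hij) rfl
      exact ⟨F', G', h', by rw [hF', UV.card_compression], by rw [hG', UV.card_compression], hst'⟩

lemma card_add_card_le_choose (h : IsFranklPair V k t F G) (hV : #V = 2 * k + t) :
    #F + #G ≤ (#V).choose k := by
  have hinj : Set.InjOn (V \ ·) (F : Set (Finset α)) := by
    intro A hA B hB hAB
    have hA' := (mem_powersetCard.1 (h.left_subset hA)).1
    have hB' := (mem_powersetCard.1 (h.left_subset hB)).1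
    rw [← Finset.sdiff_sdiff_eq_self hA', ← Finset.sdiff_sdiff_eq_self hB']
    exact congrArg (V \ ·) hAB
  have hdisj : Disjoint (F.image (V \ ·)) G := by
    rw [disjoint_left]
    intro B hB hBG
    obtain ⟨A, hA, rfl⟩ := mem_image.1 hB
    have := h.cross A hA _ hBG
    simp at this
  rw [← card_image_of_injOn hinj, ← card_union_of_disjoint hdisj, ← card_powersetCard]
  refine card_le_card (union_subset (fun B hB => ?_) h.right_subset)
  obtain ⟨A, hA, rfl⟩ := mem_image.1 hB
  have hA' := mem_powersetCard.1 (h.left_subset hA)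
  refine mem_powersetCard.2 ⟨sdiff_subset, ?_⟩
  rw [card_sdiff_of_subset hA'.1]
  omega

/-- In a compressed pair the element `j` is never needed for an intersection. -/
lemma le_card_inter_erase {W : Finset α} {r s q : ℕ} {F G : Finset (Finset α)} {j : α}
    (hF : F ⊆ powersetCard r W) (hG : G ⊆ powersetCard s W)
    (hFG : ∀ A ∈ F, ∀ B ∈ G, q ≤ #(A ∩ B)) (hW : r + s < #W + q)
    (hst : ∀ i ∈ W, i ≠ j → UV.IsCompressed {i} {j} F) {A B : Finset α} (hA : A ∈ F) (hB : B ∈ G)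
    (hjA : j ∈ A) (hjB : j ∈ B) : q ≤ #((A ∩ B).erase j) := by
  have hA' := mem_powersetCard.1 (hF hA)
  have hB' := mem_powersetCard.1 (hG hB)
  have hcard := card_erase_of_mem (mem_inter.2 ⟨hjA, hjB⟩)
  have hpos : 0 < #(A ∩ B) := card_pos.2 ⟨j, mem_inter.2 ⟨hjA, hjB⟩⟩
  have hui := card_union_add_card_inter A B
  have hq := hFG A hA B hB
  by_contra hlt
  obtain ⟨i, hiW, hi⟩ : ∃ i ∈ W, i ∉ A ∪ B :=
    exists_mem_notMem_of_card_lt_card (by omega)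
  have hiA : i ∉ A := fun h => hi (mem_union_left _ h)
  have hiB : i ∉ B := fun h => hi (mem_union_right _ h)
  have hij : i ≠ j := fun h => hiA (h ▸ hjA)
  have h1 := hFG _ ((hst i hiW hij).insert_erase_mem hA hiA hjA) B hB
  rw [insert_inter_of_notMem hiB, erase_inter] at h1
  omega

lemma memberSubfamily_subset {r : ℕ} (hF : F ⊆ powersetCard (r + 1) (insert a V)) :
    F.memberSubfamily a ⊆ powersetCard r V := by
  intro A hA
  rw [mem_memberSubfamily] at hA
  have h := mem_powersetCard.1 (hF hA.1)
  rw [card_insert_of_notMem hA.2] at h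
  exact mem_powersetCard.2 ⟨(insert_subset_insert_iff hA.2).1 h.1, by omega⟩

lemma nonMemberSubfamily_subset {r : ℕ} (hF : F ⊆ powersetCard r (insert a V)) :
    F.nonMemberSubfamily a ⊆ powersetCard r V := by
  intro A hA
  rw [mem_nonMemberSubfamily] at hA
  have h := mem_powersetCard.1 (hF hA.1)
  exact mem_powersetCard.2 ⟨(subset_insert_iff_of_notMem hA.2).1 h.1, h.2⟩

lemma nonMemberSubfamily (h : IsFranklPair (insert a V) k t F G) (ha : a ∉ V)
    (hV : k + t ≤ #V)
    (hst : ∀ i ∈ insert a V, i ≠ a → UV.IsCompressed {i} {a} F) :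
    IsFranklPair V k t (F.nonMemberSubfamily a) (G.nonMemberSubfamily a) where
  left_subset := nonMemberSubfamily_subset h.left_subset
  right_subset := nonMemberSubfamily_subset h.right_subset
  cross A hA B hB :=
    h.cross A (mem_nonMemberSubfamily.1 hA).1 B (mem_nonMemberSubfamily.1 hB).1
  inter A hA B hB :=
    h.inter A (mem_nonMemberSubfamily.1 hA).1 B (mem_nonMemberSubfamily.1 hB).1
  nonempty := by
    obtain ⟨A, hA⟩ := h.nonempty
    by_cases haA : a ∈ A
    · have hA' := mem_powersetCard.1 (h.left_subset hA)
      obtain ⟨i, hi, hiA⟩ : ∃ i ∈ insert a V, i ∉ A :=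
        exists_mem_notMem_of_card_lt_card (by rw [card_insert_of_notMem ha]; omega)
      have hia : i ≠ a := fun h => hiA (h ▸ haA)
      refine ⟨_, mem_nonMemberSubfamily.2 ⟨(hst i hi hia).insert_erase_mem hA hiA haA, ?_⟩⟩
      simp [hia.symm]
    · exact ⟨A, mem_nonMemberSubfamily.2 ⟨hA, haA⟩⟩

lemma memberSubfamily (h : IsFranklPair (insert a V) (k + 1) t F G) (ha : a ∉ V)
    (hV : 2 * (k + 1) + t ≤ #V)
    (hst : ∀ i ∈ insert a V, i ≠ a → UV.IsCompressed {i} {a} F)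
    (hne : (F.memberSubfamily a).Nonempty) :
    IsFranklPair V k t (F.memberSubfamily a) (G.memberSubfamily a) where
  left_subset := memberSubfamily_subset (by
    rw [show k + t + 1 = k + 1 + t by omega]
    exact h.left_subset)
  right_subset := memberSubfamily_subset h.right_subset
  cross A hA B hB := by
    rw [mem_memberSubfamily] at hA hB
    have := le_card_inter_erase h.left_subset h.right_subset h.cross
      (by rw [card_insert_of_notMem ha]; omega) hst hA.1 hB.1 (by simp) (by simp)
    rwa [← insert_inter_distrib, erase_insert (by simp [hA.2])] at this
  inter A hA B hB := by
    rw [mem_memberSubfamily] at hA hB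
    have := le_card_inter_erase h.left_subset h.left_subset h.inter
      (by rw [card_insert_of_notMem ha]; omega) hst hA.1 hB.1 (by simp) (by simp)
    rwa [← insert_inter_distrib, erase_insert (by simp [hA.2])] at this
  nonempty := hne

/-- Sets of `G` through `a` meet every set of `F` avoiding `a`. -/
lemma card_memberSubfamily_right_add_le (h : IsFranklPair (insert a V) (k + 1) t F G)
    (hne : (F.nonMemberSubfamily a).Nonempty) :
    #(G.memberSubfamily a) + (#V - (k + 1 + t)).choose k ≤ (#V).choose k := by
  obtain ⟨A, hA⟩ := hne
  have hA' := mem_powersetCard.1 (nonMemberSubfamily_subset h.left_subset hA)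
  rw [mem_nonMemberSubfamily] at hA
  have hdisj : Disjoint (G.memberSubfamily a) (powersetCard k (V \ A)) := by
    rw [disjoint_left]
    intro B hB hBA
    rw [mem_memberSubfamily] at hB
    have h1 := h.cross A hA.1 _ hB.1
    have h2 := (mem_powersetCard.1 hBA).1
    rw [inter_insert_of_notMem hA.2,
      disjoint_iff_inter_eq_empty.1 (disjoint_sdiff.mono_right h2)] at h1
    simp at h1
  rw [← hA'.2, ← card_sdiff_of_subset hA'.1, ← card_powersetCard, ← card_powersetCard,
    ← card_union_of_disjoint hdisj]
  exact card_le_card (union_subset (memberSubfamily_subset h.right_subset)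
    (powersetCard_mono sdiff_subset))

theorem card_add_card_add_choose_le (V : Finset α) : ∀ (k : ℕ) (F G : Finset (Finset α)),
    IsFranklPair V k t F G → 2 * k + t ≤ #V →
    #F + #G + (#V - (k + t)).choose k ≤ (#V).choose k + 1 := by
  induction V using Finset.induction_on with
  | empty =>
    intro k F G h hV
    have := h.one_le
    rw [card_empty] at hV
    omega
  | insert a V ha ih =>
    intro k F₀ G₀ h₀ hV
    obtain ⟨k, rfl⟩ : ∃ l, k = l + 1 := ⟨k - 1, by have := h₀.one_le; omega⟩
    rcases hV.eq_or_lt with hV | hV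
    · have := h₀.card_add_card_le_choose hV.symm
      rw [show #(insert a V) - (k + 1 + t) = k + 1 by omega, Nat.choose_self]
      omega
    obtain ⟨F, G, h, hF, hG, hst⟩ := exists_isCompressed (j := a) _ F₀ G₀ h₀ rfl
    rw [← hF, ← hG, ← card_memberSubfamily_add_card_nonMemberSubfamily a F,
      ← card_memberSubfamily_add_card_nonMemberSubfamily a G]
    rw [card_insert_of_notMem ha] at hV ⊢
    have hstF : ∀ i ∈ insert a V, i ≠ a → UV.IsCompressed {i} {a} F :=
      fun i hi hia => (hst i hi hia).1
    have hnon := h.nonMemberSubfamily ha (by omega) hstF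
    have h1 := ih _ _ _ hnon (by omega)
    obtain ⟨m, hm⟩ : ∃ m, #V = m + (k + 1 + t) := ⟨#V - (k + 1 + t), by omega⟩
    have e1 : #V + 1 - (k + 1 + t) = m + 1 := by omega
    have e2 : #V - (k + 1 + t) = m := by omega
    have e3 : #V - (k + t) = m + 1 := by omega
    rw [e2] at h1
    rw [e1, Nat.choose_succ_succ', Nat.choose_succ_succ']
    rcases (F.memberSubfamily a).eq_empty_or_nonempty with hE | hne
    · have h2 := h.card_memberSubfamily_right_add_le hnon.nonempty
      rw [e2] at h2
      rw [hE, card_empty]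
      omega
    · have hmem := h.memberSubfamily ha (by omega) hstF hne
      have h2 := ih _ _ _ hmem (by omega)
      obtain ⟨l, rfl⟩ : ∃ l, k = l + 1 := ⟨k - 1, by have := hmem.one_le; omega⟩
      rw [e3, Nat.choose_succ_succ'] at h2
      have h3 : 0 < m.choose l := Nat.choose_pos (by omega)
      omega

end IsFranklPair

end Frankl

/-- Frankl (2016): if `ℱ ⊆ ([n] choose k+t)` and `𝒢 ⊆ ([n] choose k)` are
cross-intersecting, `ℱ` is `(t+1)`-intersecting and nonempty, then
`|ℱ| + |𝒢| ≤ C(n,k) − C(n−k−t,k) + 1`. -/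
theorem stmt_1 (k t n : ℕ) (hk : 1 ≤ k) (hn : 2 * k + t ≤ n)
    (F G : Finset (Finset ℕ))
    (hF : F ⊆ powersetCard (k + t) (Icc 1 n))
    (hG : G ⊆ powersetCard k (Icc 1 n))
    (hcross : ∀ A ∈ F, ∀ B ∈ G, (A ∩ B).Nonempty)
    (hint : ∀ A ∈ F, ∀ B ∈ F, t + 1 ≤ (A ∩ B).card)
    (hF1 : 1 ≤ F.card) :
    (F.card : ℤ) + G.card ≤ (n.choose k : ℤ) - (n - k - t).choose k + 1 := by
  have h : IsFranklPair (Icc 1 n) k t F G :=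
    ⟨hF, hG, fun A hA B hB => (hcross A hA B hB).card_pos, hint, card_pos.1 hF1⟩
  have hle := IsFranklPair.card_add_card_add_choose_le _ _ _ _ h (by simpa using hn)
  rw [Nat.card_Icc, Nat.add_sub_cancel, ← Nat.sub_sub] at hle
  omega
end
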